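/- There exist a probability space (Ω,F,P) and a random field B̃ : ℝ × (0,1) × Ω → ℝ such that: (a) B̃ is a centered Gaussian field with covariance E[B̃(t,θ)B̃(t',θ')] = ∫_ℝ ((t−x)₊^{θ−1/2} − (−x)₊^{θ−1/2})((t'−x)₊^{θ'−1/2} − (−x)₊^{θ'−1/2}) dx for all (t,θ),(t',θ') ∈ ℝ × (0,1); and (b) there is an event Ω* with P(Ω*) = 1 such that for each ω ∈ Ω*: (i) the function (t,θ) ↦ B̃(t,θ,ω) is continuous on ℝ × (0,1); (ii) for every ε > 0 and every (s,θ) ∈ ℝ × (0,1), limsup_{h→0} |B̃(s+h,θ,ω) − B̃(s,θ,ω)| / |h|^{θ−ε} = 0 and limsup_{h→0} |B̃(s+h,θ,ω) − B̃(s,θ,ω)| / |h|^{θ+ε} = +∞; (iii) for each fixed t ∈ ℝ, the function θ ↦ B̃(t,θ,ω) is C^∞ on (0,1), with n-th derivative denoted ∂_θⁿB̃(t,θ,ω); (iv) for every n ∈ ℕ, every ε > 0 and all reals M,a,b with M > 0 and 0 < a < b < 1, there exists C(ω) > 0 such that |∂_θⁿB̃(t₁,θ₁,ω) − ∂_θⁿB̃(t₂,θ₂,ω)|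 ≤ C(ω)( |t₁−t₂|^{max{θ₁,θ₂}−ε} + |θ₁−θ₂| ) for all (t₁,θ₁),(t₂,θ₂) ∈ [−M,M] × [a,b]. -/

import Mathlib

open MeasureTheory ProbabilityTheory Filter Set Topology

noncomputable section

/-- `u₊^a`: equals `u^a` if `u > 0` and `0` otherwise. -/
def posRPow (u a : ℝ) : ℝ := if 0 < u then u ^ a else 0

/-- The fBm-type kernel `x ↦ (t−x)₊^{θ−1/2} − (−x)₊^{θ−1/2}`. -/
def fbmKernel (θ t x : ℝ) : ℝ := posRPow (t - x) (θ - 1/2) - posRPow (-x) (θ - 1/2)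


theorem L2_integral_abs_le {Ω : Type} {mΩ : MeasurableSpace Ω} {P : Measure Ω}
    [IsProbabilityMeasure P] (u : Lp ℝ 2 P) : ∫ ω, |u ω| ∂P ≤ ‖u‖ := by
  have h1 : ∫ ω, |u ω| ∂P = (eLpNorm u 1 P).toReal := by
    rw [eLpNorm_one_eq_lintegral_enorm,
      integral_eq_lintegral_of_nonneg_ae (ae_of_all _ fun _ => abs_nonneg _)
      (Lp.aestronglyMeasurable u).norm]
    congr 1
    refine lintegral_congr fun ω => ?_
    rw [← Real.norm_eq_abs, ofReal_norm]
  rw [h1, Lp.norm_def]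
  refine ENNReal.toReal_mono (Lp.eLpNorm_ne_top u) ?_
  exact eLpNorm_le_eLpNorm_of_exponent_le (by norm_num) (Lp.aestronglyMeasurable u)

theorem charFun_L2_lipschitz {Ω : Type} {mΩ : MeasurableSpace Ω} {P : Measure Ω}
    [IsProbabilityMeasure P] (ξ : ℝ) (u v : Lp ℝ 2 P) :
    ‖charFun (P.map u) ξ - charFun (P.map v) ξ‖ ≤ |ξ| * ‖u - v‖ := by
  have hm : ∀ u : Lp ℝ 2 P, AEMeasurable u P := fun u => (Lp.aestronglyMeasurable u).aemeasurable
  have hc : ∀ u : Lp ℝ 2 P, charFun (P.map u) ξ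
      = ∫ ω, Complex.exp (Complex.I * ((ξ * u ω : ℝ) : ℂ)) ∂P := by
    intro u
    rw [charFun_apply_real, integral_map (hm u) (by fun_prop)]
    congr 1; ext ω; congr 1; push_cast; ring
  have hi : ∀ u : Lp ℝ 2 P, Integrable (fun ω => Complex.exp (Complex.I * ((ξ * u ω : ℝ) : ℂ))) P := by
    intro u
    refine Integrable.of_bound (C := 1) ?_ (ae_of_all _ fun ω => ?_)
    · have : Continuous fun x : ℝ => Complex.exp (Complex.I * ((ξ * x : ℝ) : ℂ)) := by fun_prop
      exact this.comp_aestronglyMeasurable (Lp.aestronglyMeasurable u)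
    · rw [mul_comm, Complex.norm_exp_ofReal_mul_I]
  rw [hc u, hc v, ← integral_sub (hi u) (hi v)]
  refine (norm_integral_le_integral_norm _).trans ?_
  have h2 : ∫ ω, |ξ| * |(u - v) ω| ∂P ≤ |ξ| * ‖u - v‖ := by
    rw [integral_const_mul]
    exact mul_le_mul_of_nonneg_left (L2_integral_abs_le _) (abs_nonneg _)
  refine le_trans (integral_mono_ae ((hi u).sub (hi v)).norm ?_ ?_) h2
  · exact (((Lp.memLp (u - v)).integrable (by norm_num)).abs).const_mul _
  · filter_upwards [Lp.coeFn_sub u v] with ω hω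
    rw [hω, Pi.sub_apply, ← abs_mul]
    have := Real.norm_exp_I_mul_ofReal_sub_one_le (x := ξ * (u ω - v ω))
    have e : Complex.exp (Complex.I * ((ξ * u ω : ℝ) : ℂ)) - Complex.exp (Complex.I * ((ξ * v ω : ℝ) : ℂ))
       = Complex.exp (((ξ * v ω : ℝ) : ℂ) * Complex.I) *
         (Complex.exp (Complex.I * ((ξ * (u ω - v ω) : ℝ) : ℂ)) - 1) := by
      rw [mul_sub, ← Complex.exp_add, mul_one]
      congr 2 <;> push_cast <;> ring
    rw [e, norm_mul, Complex.norm_exp_ofReal_mul_I, one_mul]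
    simpa using this

/-- Existence of an isonormal Gaussian process over `L²(ℝ)`. -/
theorem exists_isonormal :
    ∃ (Ω : Type) (mΩ : MeasurableSpace Ω) (P : Measure Ω),
      IsProbabilityMeasure P ∧
      ∃ I : Lp ℝ 2 (volume : Measure ℝ) →ₗᵢ[ℝ] Lp ℝ 2 P,
        ∀ f, P.map (I f) = gaussianReal 0 (‖f‖₊ ^ 2) := by
  obtain ⟨w, b, hb⟩ := exists_hilbertBasis ℝ (Lp ℝ 2 (volume : Measure ℝ))
  classical
  let P : Measure (w → ℝ) := Measure.infinitePi (fun _ => gaussianReal 0 1)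
  have hP : IsProbabilityMeasure P := by infer_instance
  have hlaw : ∀ i : w, P.map (fun ω : w → ℝ => ω i) = gaussianReal 0 1 := fun i =>
    (measurePreserving_eval_infinitePi (fun _ : w => gaussianReal 0 1) i).map_eq
  have hind : iIndepFun (fun (i : w) (ω : w → ℝ) => ω i) P :=
    iIndepFun_infinitePi (P := fun _ : w => gaussianReal 0 1) (X := fun _ x => x) (fun _ => measurable_id)
  have hG : ∀ i : w, HasGaussianLaw (fun ω : w → ℝ => ω i) P := fun i =>
    ⟨by rw [hlaw]; infer_instance⟩
  have hmem : ∀ i : w, MemLp (fun ω : w → ℝ => ω i) 2 P := fun i => (hG i).memLp_two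
  have hmean : ∀ i : w, ∫ ω, ω i ∂P = 0 := by
    intro i
    have := integral_map (μ := P) (φ := fun ω : w → ℝ => ω i) (f := fun x : ℝ => x)
      (measurable_pi_apply i).aemeasurable (by fun_prop)
    rw [← this, hlaw]; simp
  have hsq : ∀ i : w, ∫ ω, ω i * ω i ∂P = 1 := by
    intro i
    have := integral_map (μ := P) (φ := fun ω : w → ℝ => ω i) (f := fun x : ℝ => x * x)
      (measurable_pi_apply i).aemeasurable (by fun_prop)
    rw [← this, hlaw]
    have h := variance_fun_id_gaussianReal (μ := 0) (v := 1)
    rw [variance_eq_sub (X := fun x : ℝ => x) (memLp_id_gaussianReal 2)] at h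
    simpa [pow_two] using h
  let g : w → Lp ℝ 2 P := fun i => (hmem i).toLp _
  have hgc : ∀ i, g i =ᵐ[P] fun ω => ω i := fun i => (hmem i).coeFn_toLp
  have hon : Orthonormal ℝ g := by
    rw [orthonormal_iff_ite]
    intro i j
    rw [L2.inner_def]
    have : ∫ a, inner ℝ ((g i) a) ((g j) a) ∂P = ∫ ω : w → ℝ, ω i * ω j ∂P := by
      refine integral_congr_ae ?_
      filter_upwards [hgc i, hgc j] with ω h1 h2
      simp [h1, h2, mul_comm]
    rw [this]
    split_ifs with h
    · subst h; exact hsq i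
    · have := (hind.indepFun h).integral_mul_eq_mul_integral
        (measurable_pi_apply i).aestronglyMeasurable (measurable_pi_apply j).aestronglyMeasurable
      have h3 : ∫ ω : w → ℝ, ω i * ω j ∂P = (∫ ω, ω i ∂P) * ∫ ω, ω j ∂P := this
      rw [h3, hmean, zero_mul]
  let I : Lp ℝ 2 (volume : Measure ℝ) →ₗᵢ[ℝ] Lp ℝ 2 P :=
    hon.orthogonalFamily.linearIsometry.comp b.repr.toLinearIsometry
  have hI : ∀ i, I (b i) = g i := by
    intro i
    have h0 : I (b i) = hon.orthogonalFamily.linearIsometry (b.repr (b i)) := rfl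
    rw [h0, b.repr_self]
    have := hon.orthogonalFamily.linearIsometry_apply_single (i := i) (1 : ℝ)
    rw [this]; simp
  refine ⟨w → ℝ, inferInstance, P, hP, I, ?_⟩
  -- the good set
  have hspan : ∀ f ∈ Submodule.span ℝ (Set.range b), P.map (I f) = gaussianReal 0 (‖f‖₊ ^ 2) := by
    intro f hf
    rw [Finsupp.mem_span_range_iff_exists_finsupp] at hf
    obtain ⟨c, rfl⟩ := hf
    set f := c.sum fun i a => a • b i
    have hae : I f =ᵐ[P] fun ω => ∑ i : c.support, c i * ω i := by
      have e : I f = ∑ i ∈ c.support, c i • g i := by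
        simp [f, Finsupp.sum, map_sum, hI]
      rw [e]
      have h1 := Lp.coeFn_finsetSum c.support (fun i => c i • g i)
      have h2 : ∀ᵐ ω ∂P, ∀ i ∈ c.support, (c i • g i : Lp ℝ 2 P) ω = c i * ω i := by
        refine (ae_ball_iff c.support.countable_toSet).2 ?_
        intro i _
        filter_upwards [Lp.coeFn_smul (c i) (g i), hgc i] with ω h3 h4
        rw [h3, Pi.smul_apply, h4, smul_eq_mul]
      filter_upwards [h1, h2] with ω h3 h4
      rw [h3, Finset.sum_apply, Finset.sum_congr rfl h4]
      exact (Finset.sum_coe_sort c.support (fun i => c i * ω i)).symm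
    have hGL : HasGaussianLaw (fun ω : w → ℝ => ∑ i : c.support, c i * ω i) P := by
      have h1 : iIndepFun (fun (i : c.support) (ω : w → ℝ) => ω i) P :=
        hind.precomp Subtype.val_injective
      have h2 := iIndepFun.hasGaussianLaw (fun i : c.support => hG i) h1
      let L : (c.support → ℝ) →L[ℝ] ℝ := ∑ i : c.support, (c i) • ContinuousLinearMap.proj i
      have h3 := h2.map_fun L
      refine h3.congr (ae_of_all _ fun ω => ?_)
      simp [L]
    rw [Measure.map_congr hae, hGL.map_eq_gaussianReal]
    have hm0 : ∫ ω : w → ℝ, ∑ i : c.support, c i * ω i ∂P = 0 := by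
      rw [integral_finsetSum Finset.univ (f := fun (i : c.support) (ω : w → ℝ) => c i * ω i) fun i _ => ((hG i).integrable.const_mul _)]
      refine Finset.sum_eq_zero fun i _ => ?_
      rw [integral_const_mul, hmean, mul_zero]
    rw [variance_of_integral_eq_zero hGL.aemeasurable hm0, hm0]
    congr 1
    have h5 : ∫ ω : w → ℝ, (∑ i : c.support, c i * ω i) ^ 2 ∂P = ‖f‖ ^ 2 := by
      rw [← I.norm_map, ← real_inner_self_eq_norm_sq, L2.inner_def]
      refine integral_congr_ae ?_
      filter_upwards [hae] with ω h
      simp [h, pow_two]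
    rw [h5]
    ext
    simp
  intro f
  refine Measure.ext_of_charFun ?_
  ext ξ
  have hclosed : IsClosed {f : Lp ℝ 2 (volume : Measure ℝ) |
      charFun (P.map (I f)) ξ = Complex.exp (-((‖f‖ : ℝ):ℂ) ^ 2 * ξ ^ 2 / 2)} := by
    refine isClosed_eq ?_ (by fun_prop)
    have : LipschitzWith ‖ξ‖₊ (fun f => charFun (P.map (I f)) ξ) := by
      refine LipschitzWith.of_dist_le_mul fun u v => ?_
      rw [dist_eq_norm, ← I.dist_map, dist_eq_norm]
      exact charFun_L2_lipschitz ξ (I u) (I v)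
    exact this.continuous
  have hd : Dense (Submodule.span ℝ (Set.range b) : Set (Lp ℝ 2 (volume : Measure ℝ))) := by
    rw [Submodule.dense_iff_topologicalClosure_eq_top]; exact b.dense_span
  have hall : f ∈ {f : Lp ℝ 2 (volume : Measure ℝ) |
      charFun (P.map (I f)) ξ = Complex.exp (-((‖f‖ : ℝ):ℂ) ^ 2 * ξ ^ 2 / 2)} := by
    have := (hclosed.closure_subset_iff (s := (Submodule.span ℝ (Set.range b) : Set (Lp ℝ 2 (volume : Measure ℝ))))).2 ?_ (hd f)
    · exact this
    · intro f hf
      simp only [Set.mem_ofPred_eq]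
      rw [hspan f hf, charFun_gaussianReal]
      congr 1
      push_cast
      simp
      ring
  rw [hall, charFun_gaussianReal]
  congr 1
  push_cast
  simp
  ring

/-- Function-level interface to an isonormal process. -/
structure IsoProc {Ω : Type} {mΩ : MeasurableSpace Ω} (P : Measure Ω) (X : (ℝ → ℝ) → Ω → ℝ) : Prop where
  meas : ∀ f, Measurable (X f)
  law : ∀ f, MemLp f 2 volume → P.map (X f) = gaussianReal 0 (∫ x, f x ^ 2).toNNReal
  lin : ∀ (f g : ℝ → ℝ) (a b : ℝ), MemLp f 2 volume → MemLp g 2 volume →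
    X (fun x => a * f x + b * g x) =ᵐ[P] fun ω => a * X f ω + b * X g ω
  inner : ∀ f g : ℝ → ℝ, MemLp f 2 volume → MemLp g 2 volume →
    ∫ ω, X f ω * X g ω ∂P = ∫ x, f x * g x
  memLp : ∀ f, MemLp (X f) 2 P

theorem exists_isoProc : ∃ (Ω : Type) (mΩ : MeasurableSpace Ω) (P : Measure Ω),
      IsProbabilityMeasure P ∧ ∃ X : (ℝ → ℝ) → Ω → ℝ, IsoProc P X := by
  obtain ⟨Ω, mΩ, P, hP, I, hI⟩ := exists_isonormal
  classical
  let X : (ℝ → ℝ) → Ω → ℝ := fun f => if h : MemLp f 2 volume then I (h.toLp f) else 0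
  have hX : ∀ f, (h : MemLp f 2 volume) → X f = I (h.toLp f) := fun f h => by simp [X, h]
  have hinner : ∀ f g : ℝ → ℝ, MemLp f 2 volume → MemLp g 2 volume →
    ∫ ω, X f ω * X g ω ∂P = ∫ x, f x * g x := by
    intro f g hf hg
    rw [hX f hf, hX g hg]
    have h1 := I.inner_map_map (hf.toLp f) (hg.toLp g)
    rw [L2.inner_def, L2.inner_def] at h1
    have h2 : ∫ a, inner ℝ ((hf.toLp f) a) ((hg.toLp g) a) = ∫ x, f x * g x := by
      refine integral_congr_ae ?_
      filter_upwards [hf.coeFn_toLp, hg.coeFn_toLp] with x h3 h4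
      simp [h3, h4, mul_comm]
    rw [← h2, ← h1]
    refine integral_congr_ae (ae_of_all _ fun ω => ?_)
    simp [mul_comm]
  refine ⟨Ω, mΩ, P, hP, X, ⟨?_, ?_, ?_, hinner, ?_⟩⟩
  · intro f
    by_cases h : MemLp f 2 volume
    · rw [hX f h]; exact (Lp.stronglyMeasurable _).measurable
    · simp only [X, h, dif_neg, not_false_iff]; exact measurable_zero
  · intro f h
    rw [hX f h, hI]
    congr 1
    have h1 : ∫ x, f x ^ 2 = ‖h.toLp f‖ ^ 2 := by
      rw [← real_inner_self_eq_norm_sq, L2.inner_def]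
      refine integral_congr_ae ?_
      filter_upwards [h.coeFn_toLp] with x h3
      simp [h3, pow_two]
    rw [h1]; ext
    rw [Real.coe_toNNReal _ (by positivity)]; rfl
  · intro f g a b hf hg
    have hs : MemLp (fun x => a * f x + b * g x) 2 volume := (hf.const_mul a).add (hg.const_mul b)
    rw [hX f hf, hX g hg, hX _ hs]
    have e : hs.toLp _ = a • hf.toLp f + b • hg.toLp g := by
      rw [← MemLp.toLp_const_smul, ← MemLp.toLp_const_smul, ← MemLp.toLp_add]; rfl
    rw [e, map_add, map_smul, map_smul]
    filter_upwards [Lp.coeFn_add (a • I (hf.toLp f)) (b • I (hg.toLp g)),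
      Lp.coeFn_smul a (I (hf.toLp f)), Lp.coeFn_smul b (I (hg.toLp g))] with ω h1 h2 h3
    rw [h1, Pi.add_apply, h2, h3]; rfl
  · intro f
    by_cases h : MemLp f 2 volume
    · rw [hX f h]; exact Lp.memLp _
    · simp only [X, h, dif_neg, not_false_iff]; exact MemLp.zero

namespace IsoProc
variable {Ω : Type} {mΩ : MeasurableSpace Ω} {P : Measure Ω} {X : (ℝ → ℝ) → Ω → ℝ}

theorem sub (h : IsoProc P X) {f g : ℝ → ℝ} (hf : MemLp f 2 volume) (hg : MemLp g 2 volume) :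
    X (fun x => f x - g x) =ᵐ[P] fun ω => X f ω - X g ω := by
  have := h.lin f g 1 (-1) hf hg
  simpa [sub_eq_add_neg] using this

theorem zero (h : IsoProc P X) : X (fun _ => 0) =ᵐ[P] fun _ => 0 := by
  have := h.lin (fun _ => 0) (fun _ => 0) 0 0 MemLp.zero MemLp.zero
  simpa using this

theorem smul (h : IsoProc P X) {f : ℝ → ℝ} (a : ℝ) (hf : MemLp f 2 volume) :
    X (fun x => a * f x) =ᵐ[P] fun ω => a * X f ω := by
  have := h.lin f f a 0 hf hf
  simpa using this

theorem sum (h : IsoProc P X) {ι : Type*} (s : Finset ι) (c : ι → ℝ) (f : ι → ℝ → ℝ)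
    (hf : ∀ i ∈ s, MemLp (f i) 2 volume) :
    X (fun x => ∑ i ∈ s, c i * f i x) =ᵐ[P] fun ω => ∑ i ∈ s, c i * X (f i) ω := by
  classical
  induction s using Finset.induction_on with
  | empty => simpa using h.zero
  | insert a s ha ih =>
    have h1 : MemLp (fun x => ∑ i ∈ s, c i * f i x) 2 volume :=
      memLp_finsetSum s fun i hi => (hf i (Finset.mem_insert_of_mem hi)).const_mul _
    have h2 := h.lin (f a) (fun x => ∑ i ∈ s, c i * f i x) (c a) 1 (hf a (Finset.mem_insert_self _ _)) h1
    simp only [one_mul] at h2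
    simp only [Finset.sum_insert ha]
    filter_upwards [h2, ih fun i hi => hf i (Finset.mem_insert_of_mem hi)] with ω h3 h4
    rw [h3, h4]

theorem hasGaussianLaw (h : IsoProc P X) {f : ℝ → ℝ} (hf : MemLp f 2 volume) :
    HasGaussianLaw (X f) P := ⟨by rw [h.law f hf]; infer_instance⟩

theorem mean (h : IsoProc P X) {f : ℝ → ℝ} (hf : MemLp f 2 volume) : ∫ ω, X f ω ∂P = 0 := by
  have := integral_map (μ := P) (φ := X f) (f := fun x : ℝ => x) (h.meas f).aemeasurable (by fun_prop)
  rw [← this, h.law f hf]; simp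

/-- Limits in `L²`. -/
theorem limit (h : IsoProc P X) {f : ℕ → ℝ → ℝ} {g : ℝ → ℝ} (hf : ∀ n, MemLp (f n) 2 volume)
    (hg : MemLp g 2 volume) (hlim : Tendsto (fun n => ∫ x, (f n x - g x) ^ 2) atTop (𝓝 0))
    {Y : Ω → ℝ} (hY : ∀ᵐ ω ∂P, Tendsto (fun n => X (f n) ω) atTop (𝓝 (Y ω))) :
    X g =ᵐ[P] Y := by
  have h1 : ∀ n, ∫ ω, (X (f n) ω - X g ω) ^ 2 ∂P = ∫ x, (f n x - g x) ^ 2 := by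
    intro n
    have hs : MemLp (fun x => f n x - g x) 2 volume := (hf n).sub hg
    have := h.inner _ _ hs hs
    simp only [pow_two]
    rw [← this]
    refine integral_congr_ae ?_
    filter_upwards [h.sub (hf n) hg] with ω hω
    rw [hω]
  have h2 : Tendsto (fun n => eLpNorm (X (f n) - X g) 2 P) atTop (𝓝 0) := by
    have h3 : ∀ n, eLpNorm (X (f n) - X g) 2 P
        = ENNReal.ofReal (∫ x, (f n x - g x) ^ 2) ^ (1 / 2 : ℝ) := by
      intro n
      have hm : MemLp (X (f n) - X g) 2 P := (h.memLp _).sub (h.memLp _)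
      rw [eLpNorm_eq_lintegral_rpow_enorm_toReal (by norm_num) (by norm_num), ← h1]
      simp only [ENNReal.toReal_ofNat]
      congr 1
      rw [ofReal_integral_eq_lintegral_ofReal]
      · refine lintegral_congr fun ω => ?_
        rw [Pi.sub_apply, Real.enorm_eq_ofReal_abs, ENNReal.ofReal_rpow_of_nonneg (abs_nonneg _) (by norm_num)]
        norm_num
      · exact hm.integrable_sq
      · exact ae_of_all _ fun _ => by positivity
    simp only [h3]
    have := (ENNReal.continuous_rpow_const (y := (1/2 : ℝ))).tendsto _ |>.comp
      ((ENNReal.continuous_ofReal.tendsto _).comp hlim)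
    simpa [Function.comp_def] using this
  have h4 := tendstoInMeasure_of_tendsto_eLpNorm (by norm_num) (fun n => (h.meas (f n)).aestronglyMeasurable)
    (h.meas g).aestronglyMeasurable h2
  obtain ⟨ns, hns, h5⟩ := h4.exists_seq_tendsto_ae
  filter_upwards [h5, hY] with ω h6 h7
  exact tendsto_nhds_unique h6 (h7.comp hns.tendsto_atTop)

theorem congr (h : IsoProc P X) {f g : ℝ → ℝ} (hf : MemLp f 2 volume) (hg : MemLp g 2 volume)
    (hfg : f =ᵐ[volume] g) : X f =ᵐ[P] X g := by
  refine (h.limit (f := fun _ => f) (g := g) (Y := X f) (fun _ => hf) hg ?_ ?_).symm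
  · have : ∫ x, (f x - g x) ^ 2 = 0 := by
      rw [integral_congr_ae (g := fun _ => 0)]
      · simp
      · filter_upwards [hfg] with x hx
        simp [hx]
    simp [this]
  · exact ae_of_all _ fun ω => tendsto_const_nhds

theorem gauss_family (h : IsoProc P X) {T : Type} (f : T → ℝ → ℝ)
    (hf : ∀ i, MemLp (f i) 2 volume) : IsGaussianProcess (fun i => X (f i)) P := by
  classical
  refine ⟨fun s => ⟨⟨fun L => ?_⟩⟩⟩
  have hm : Measurable fun ω => s.restrict (fun i => X (f i) ω) :=
    measurable_pi_lambda _ fun i => h.meas _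
  have e : (fun ω => L (s.restrict (fun i => X (f i) ω)))
      =ᵐ[P] X (fun x => ∑ i : s, L (Pi.single i 1) * f i x) := by
    filter_upwards [h.sum Finset.univ (fun i : s => L (Pi.single i 1)) (fun i => f i) (fun i _ => hf i)] with ω hω
    rw [hω]
    have := L.toLinearMap.pi_apply_eq_sum_univ (s.restrict (fun i => X (f i) ω))
    simp only [ContinuousLinearMap.coe_coe] at this
    rw [this]
    refine Finset.sum_congr rfl fun i _ => ?_
    rw [smul_eq_mul, mul_comm]; congr 2
    ext j; simp [Pi.single_apply, eq_comm]
  have hs : MemLp (fun x => ∑ i : s, L (Pi.single i 1) * f i x) 2 volume :=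
    memLp_finsetSum _ fun i hi => (hf i).const_mul _
  have hG := (h.hasGaussianLaw hs).congr e.symm
  have := hG.map_eq_gaussianReal
  rw [Measure.map_map (by fun_prop) hm, integral_map hm.aemeasurable (by fun_prop),
    variance_map (by fun_prop) hm.aemeasurable]
  exact this

theorem indep (h : IsoProc P X) {T : Type} {g : ℝ → ℝ} (f : T → ℝ → ℝ)
    (hg : MemLp g 2 volume)
    (hf : ∀ i, MemLp (f i) 2 volume) (h0 : ∀ i, ∫ x, g x * f i x = 0) :
    IndepFun (X g) (fun ω i => X (f i) ω) P := by
  have h1 : IsGaussianProcess (Sum.elim (fun _ : Unit => X g) (fun i => X (f i))) P := by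
    have := h.gauss_family (Sum.elim (fun _ : Unit => g) f) (by rintro (_ | i); exacts [hg, hf i])
    convert this using 1
    ext i; cases i <;> rfl
  have hP := h1.isProbabilityMeasure
  have h2 := h1.indepFun_of_covariance_eq_zero (fun _ => (h.meas _).aemeasurable)
    (fun _ => (h.meas _).aemeasurable) (fun _ i => by
      rw [covariance_eq_sub (h.memLp _) (h.memLp _), h.mean hg, zero_mul, sub_zero]
      exact (h.inner g (f i) hg (hf i)).trans (h0 i))
  exact h2.comp (φ := fun u : Unit → ℝ => u ()) (ψ := id) (measurable_pi_apply _) measurable_id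

end IsoProc


theorem gauss_tail (p : ℕ) : ∃ c : ENNReal, c ≠ ⊤ ∧ ∀ (σ L : ℝ) (v : NNReal), 0 < L → 0 < σ →
    (v : ℝ) ≤ σ ^ 2 → gaussianReal 0 v {x | σ * L ≤ |x|} ≤ c * ENNReal.ofReal ((L ^ p)⁻¹) := by
  refine ⟨∫⁻ x, ‖x‖ₑ ^ (p : ℝ) ∂(gaussianReal 0 1), ?_, ?_⟩
  · have h := memLp_id_gaussianReal (μ := 0) (v := 1) (p : NNReal)
    by_cases hp : p = 0
    · subst hp; simp
    · have := lintegral_rpow_enorm_lt_top_of_eLpNorm_lt_top (p := ((p : NNReal) : ENNReal)) (by simpa using hp) (by simp) h.2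
      simpa using this.ne
  · intro σ L v hL hσ hv
    have e : gaussianReal 0 v = (gaussianReal 0 1).map (fun x => √(v:ℝ) * x) := by
      rw [gaussianReal_map_const_mul]
      congr 1
      · simp
      · ext; simp
    rw [e, Measure.map_apply (by fun_prop) (measurableSet_le (by fun_prop) (by fun_prop))]
    have hs : √(v:ℝ) ≤ σ := by
      rw [Real.sqrt_le_left hσ.le]; exact hv
    have h1 : ((fun x => √(v:ℝ) * x) ⁻¹' {x | σ * L ≤ |x|}) ⊆ {x : ℝ | ENNReal.ofReal (L ^ p) ≤ ‖x‖ₑ ^ (p : ℝ)} := by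
      intro x hx
      simp only [Set.mem_preimage, Set.mem_ofPred_eq, abs_mul, abs_of_nonneg (Real.sqrt_nonneg _)] at hx ⊢
      have h2 : L ≤ |x| := by
        have : σ * L ≤ σ * |x| := hx.trans (by gcongr)
        exact le_of_mul_le_mul_left this hσ
      rw [ENNReal.rpow_natCast, ← ofReal_norm, ← ENNReal.ofReal_pow (norm_nonneg _)]
      apply ENNReal.ofReal_le_ofReal
      rw [Real.norm_eq_abs]
      gcongr
    refine (measure_mono h1).trans ?_
    refine (meas_ge_le_lintegral_div (by fun_prop) (by simpa using by positivity) (by simp)).trans ?_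
    rw [ENNReal.div_eq_inv_mul, mul_comm, ENNReal.ofReal_inv_of_pos (by positivity)]

namespace IsoProc
variable {Ω : Type} {mΩ : MeasurableSpace Ω} {P : Measure Ω} {X : (ℝ → ℝ) → Ω → ℝ}

theorem ae_bound (h : IsoProc P X) {ι : Type} [Countable ι] (f : ι → ℝ → ℝ) (σ L : ι → ℝ)
    (hf : ∀ i, MemLp (f i) 2 volume) (hσ : ∀ i, 0 < σ i) (hfσ : ∀ i, ∫ x, f i x ^ 2 ≤ σ i ^ 2)
    (hL : ∀ i, 0 < L i) (p : ℕ) (hs : Summable fun i => (L i ^ p)⁻¹) :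
    ∀ᵐ ω ∂P, ∃ C : ℝ, 0 < C ∧ ∀ i, |X (f i) ω| ≤ C * (σ i * L i) := by
  obtain ⟨c, hc, hb⟩ := gauss_tail p
  have key : ∀ᵐ ω ∂P, {i | ω ∈ {ω | σ i * L i ≤ |X (f i) ω|}}.Finite := by
    apply ae_finite_setOfPred_mem
    have : ∀ i, P {ω | σ i * L i ≤ |X (f i) ω|} ≤ c * ENNReal.ofReal ((L i ^ p)⁻¹) := by
      intro i
      have := hb (σ i) (L i) (∫ x, f i x ^ 2).toNNReal (hL i) (hσ i)
        (by rw [Real.coe_toNNReal _ (integral_nonneg fun x => by positivity)]; exact hfσ i)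
      rwa [← h.law _ (hf i), Measure.map_apply (h.meas _) (measurableSet_le (by fun_prop) (by fun_prop))] at this
    refine ne_top_of_le_ne_top ?_ (ENNReal.tsum_le_tsum this)
    rw [ENNReal.tsum_mul_left]
    exact ENNReal.mul_ne_top hc hs.tsum_ofReal_ne_top
  filter_upwards [key] with ω hω
  refine ⟨1 + ∑ i ∈ hω.toFinset, |X (f i) ω| / (σ i * L i), ?_, fun i => ?_⟩
  · have : 0 ≤ ∑ i ∈ hω.toFinset, |X (f i) ω| / (σ i * L i) := Finset.sum_nonneg fun i _ => by
      have := hσ i; have := hL i; positivity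
    linarith
  · have hp : 0 < σ i * L i := mul_pos (hσ i) (hL i)
    have nn : ∀ i, 0 ≤ |X (f i) ω| / (σ i * L i) := fun i => by
      have := hσ i; have := hL i; positivity
    rw [← div_le_iff₀ hp]
    by_cases hi : σ i * L i ≤ |X (f i) ω|
    · have := Finset.single_le_sum (f := fun i => |X (f i) ω| / (σ i * L i)) (fun i _ => nn i) (hω.mem_toFinset.2 hi)
      linarith
    · have : |X (f i) ω| / (σ i * L i) ≤ 1 := by rw [div_le_one hp]; linarith
      have : 0 ≤ ∑ i ∈ hω.toFinset, |X (f i) ω| / (σ i * L i) := Finset.sum_nonneg fun i _ => nn i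
      linarith

end IsoProc

theorem summable_index (p : ℕ) (hp : 2 ≤ p) :
    Summable fun i : ℕ × ℤ × ℕ => ((((i.2.2 : ℝ) + 1) * (|(i.2.1 : ℝ)| + 1) * ((i.1 : ℝ) + 1)) ^ p)⁻¹ := by
  have h1 : Summable fun n : ℕ => (((n : ℝ) + 1) ^ p)⁻¹ := by
    have := (summable_nat_add_iff 1).2 (Real.summable_nat_pow_inv.2 (by omega : 1 < p))
    simpa using this
  have h2 : Summable fun n : ℤ => ((|(n : ℝ)| + 1) ^ p)⁻¹ := by
    apply Summable.of_nat_of_neg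
    · simpa using h1
    · simpa using h1
  have := h1.mul_of_nonneg (h2.mul_of_nonneg h1 (fun n => by positivity) (fun n => by positivity)) (fun n => by positivity) (fun n => by simp only [Pi.zero_apply]; positivity)
  refine this.congr fun i => ?_
  rw [← mul_inv, ← mul_inv, ← mul_pow, ← mul_pow]
  congr 2; ring


/-- one-sided log power -/
def plog (n : ℕ) (v : ℝ) : ℝ := if 0 < v then Real.log v ^ n / n.factorial else 0
/-- Taylor coefficients of the normalised increment kernel -/
def ell (n : ℕ) (v : ℝ) : ℝ := plog n v - plog n (v - 1)
/-- normalised increment kernel -/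
def kfun (a v : ℝ) : ℝ := posRPow v a - posRPow (v - 1) a

def dom1 (r v : ℝ) : ℝ := (Ioc (0:ℝ) 2).indicator (fun v => 3 * v ^ (-r)) v
def dom2 (r v : ℝ) : ℝ := (Ioi (1:ℝ)).indicator (fun v => v ^ (r - 1)) v
def dom (r v : ℝ) : ℝ := dom1 r v + dom1 r (v - 1) + dom2 r (v - 1)

theorem dom1_nonneg (r v : ℝ) : 0 ≤ dom1 r v :=
  indicator_nonneg (fun v hv => by have := hv.1; positivity) v
theorem dom2_nonneg (r v : ℝ) : 0 ≤ dom2 r v :=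
  indicator_nonneg (fun v hv => by have : (0:ℝ) < v := lt_trans one_pos hv; positivity) v
theorem dom_nonneg (r v : ℝ) : 0 ≤ dom r v := by
  have := dom1_nonneg r v; have := dom1_nonneg r (v-1); have := dom2_nonneg r (v-1)
  unfold dom; linarith

theorem measurable_plog (n : ℕ) : Measurable (plog n) :=
  Measurable.ite measurableSet_Ioi (by fun_prop) (by fun_prop)
theorem measurable_ell (n : ℕ) : Measurable (ell n) :=
  (measurable_plog n).sub ((measurable_plog n).comp (by fun_prop))
theorem measurable_posRPow (a : ℝ) : Measurable (fun u => posRPow u a) :=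
  Measurable.ite measurableSet_Ioi (by fun_prop) (by fun_prop)
theorem measurable_kfun (a : ℝ) : Measurable (kfun a) :=
  (measurable_posRPow a).sub ((measurable_posRPow a).comp (by fun_prop))

theorem memLp_dom1 {r : ℝ} (hr : r < 1/2) : MemLp (dom1 r) 2 volume := by
  have hm : Measurable (dom1 r) := Measurable.indicator (by fun_prop) measurableSet_Ioc
  rw [memLp_two_iff_integrable_sq hm.aestronglyMeasurable]
  have h : Integrable ((Ioc (0:ℝ) 2).indicator (fun v => 9 * v ^ (-r*2))) volume := by
    rw [integrable_indicator_iff measurableSet_Ioc]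
    apply Integrable.const_mul
    rw [← IntegrableOn, ← intervalIntegrable_iff_integrableOn_Ioc_of_le (by norm_num)]
    exact intervalIntegral.intervalIntegrable_rpow' (by linarith)
  refine h.congr (Eventually.of_forall fun v => ?_)
  simp only [dom1, indicator]
  split_ifs with hv
  · rw [Real.rpow_mul hv.1.le, mul_pow]; norm_num
  · simp

theorem memLp_dom2 {r : ℝ} (hr : r < 1/2) : MemLp (dom2 r) 2 volume := by
  have hm : Measurable (dom2 r) := Measurable.indicator (by fun_prop) measurableSet_Ioi
  rw [memLp_two_iff_integrable_sq hm.aestronglyMeasurable]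
  have h : Integrable ((Ioi (1:ℝ)).indicator (fun v => v ^ ((r-1)*2))) volume := by
    rw [integrable_indicator_iff measurableSet_Ioi]
    exact integrableOn_Ioi_rpow_of_lt (by linarith) one_pos
  refine h.congr (Eventually.of_forall fun v => ?_)
  simp only [dom2, indicator]
  split_ifs with hv
  · rw [Real.rpow_mul (le_of_lt (lt_trans one_pos hv))]; norm_num
  · simp

theorem memLp_dom {r : ℝ} (hr : r < 1/2) : MemLp (dom r) 2 volume :=
  ((memLp_dom1 hr).add ((memLp_dom1 hr).comp_measurePreserving (measurePreserving_sub_right volume 1))).add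
    ((memLp_dom2 hr).comp_measurePreserving (measurePreserving_sub_right volume 1))

theorem plog_bound {r : ℝ} (h0 : 0 < r) (hr : r < 1/2) (n : ℕ) (v : ℝ) (hv : v ≤ 2) :
    r ^ n * |plog n v| ≤ dom1 r v := by
  unfold plog dom1
  by_cases h : 0 < v
  · rw [if_pos h, indicator_of_mem (show v ∈ Ioc (0:ℝ) 2 from ⟨h, hv⟩)]
    have h1 := Real.pow_div_factorial_le_exp (r * |Real.log v|) (by positivity) n
    have h2 : r ^ n * |Real.log v ^ n / n.factorial| = (r * |Real.log v|) ^ n / n.factorial := by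
      rw [abs_div, abs_pow, Nat.abs_cast, mul_pow]; ring
    rw [h2]
    refine h1.trans ?_
    rcases le_total v 1 with h3 | h3
    · rw [abs_of_nonpos (Real.log_nonpos h.le h3), Real.rpow_def_of_pos h]
      have e : r * -Real.log v = Real.log v * -r := by ring
      rw [e]
      have := Real.exp_pos (Real.log v * -r)
      linarith
    · rw [abs_of_nonneg (Real.log_nonneg h3)]
      have e : Real.exp (r * Real.log v) = v ^ r := by rw [Real.rpow_def_of_pos h, mul_comm]
      rw [e, Real.rpow_neg h.le, ← div_eq_mul_inv, le_div_iff₀ (by positivity), ← Real.rpow_add h]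
      calc v ^ (r + r) ≤ v ^ (1:ℝ) := Real.rpow_le_rpow_of_exponent_le h3 (by linarith)
        _ ≤ 3 := by rw [Real.rpow_one]; linarith
  · rw [if_neg h]
    simp only [abs_zero, mul_zero]
    exact dom1_nonneg r v

theorem ell_bound {r : ℝ} (h0 : 0 < r) (hr : r < 1/2) (n : ℕ) (v : ℝ) :
    r ^ n * |ell n v| ≤ dom r v := by
  have d1 := dom1_nonneg r v
  have d2 := dom1_nonneg r (v-1)
  have d3 := dom2_nonneg r (v-1)
  rcases le_or_gt v 2 with hv | hv
  · have h1 := plog_bound h0 hr n v hv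
    have h2 := plog_bound h0 hr n (v-1) (by linarith)
    calc r ^ n * |ell n v| ≤ r ^ n * (|plog n v| + |plog n (v-1)|) := by
          gcongr; exact abs_sub _ _
      _ ≤ _ := by rw [mul_add]; unfold dom; linarith
  · have hD : dom2 r (v-1) = (v-1) ^ (r-1) := indicator_of_mem (by simp only [mem_Ioi]; linarith) _
    have hw : 1 < v - 1 := by linarith
    suffices r ^ n * |ell n v| ≤ (v-1) ^ (r-1) by unfold dom; linarith
    unfold ell plog
    rw [if_pos (by linarith), if_pos (by linarith)]
    rcases n with _ | n
    · have : 0 < v - 1 := by linarith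
      simp; positivity
    · have key := Convex.norm_image_sub_le_of_norm_hasDerivWithin_le (f := fun u => r ^ (n+1) * (Real.log u ^ (n+1) / (n+1).factorial))
        (f' := fun u => r ^ (n+1) * (Real.log u ^ n * u⁻¹ / n.factorial)) (s := Icc (v-1) v) (x := v-1) (y := v) (C := (v-1)^(r-1))
        ?_ ?_ (convex_Icc _ _) ⟨le_rfl, by linarith⟩ ⟨by linarith, le_rfl⟩
      · rw [← mul_sub, Real.norm_eq_abs, abs_mul, abs_of_nonneg (by positivity : 0 ≤ r ^ (n+1))] at key
        simpa using key
      · intro u hu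
        have hu0 : 0 < u := by linarith [hu.1]
        have := ((((Real.hasDerivAt_log hu0.ne').pow (n+1)).div_const ((n+1).factorial:ℝ)).const_mul (r^(n+1))).hasDerivWithinAt (s := Icc (v-1) v)
        refine HasDerivWithinAt.congr_deriv this ?_
        rw [Nat.factorial_succ, Nat.add_sub_cancel]
        push_cast
        have : (n.factorial : ℝ) ≠ 0 := by positivity
        field_simp
      · intro u hu
        have hu0 : 0 < u := by linarith [hu.1]
        have hl : 0 ≤ Real.log u := Real.log_nonneg (by linarith [hu.1])
        rw [Real.norm_eq_abs, abs_of_nonneg (by positivity)]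
        have h1 := Real.pow_div_factorial_le_exp (r * Real.log u) (by positivity) n
        have e : Real.exp (r * Real.log u) = u ^ r := by rw [Real.rpow_def_of_pos hu0, mul_comm]
        rw [e] at h1
        calc r ^ (n+1) * (Real.log u ^ n * u⁻¹ / n.factorial)
            = r * (((r * Real.log u)^n / n.factorial) * u⁻¹) := by rw [mul_pow]; ring
          _ ≤ 1 * (u ^ r * u⁻¹) := by gcongr; linarith
          _ = u ^ (r - 1) := by rw [Real.rpow_sub_one hu0.ne']; ring
          _ ≤ _ := Real.rpow_le_rpow_of_nonpos (by linarith) hu.1 (by linarith)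

theorem posRPow_hasSum (a v : ℝ) : HasSum (fun n => a ^ n * plog n v) (posRPow v a) := by
  unfold plog posRPow
  split_ifs with h
  · have := NormedSpace.expSeries_div_hasSum_exp (a * Real.log v)
    rw [← Real.exp_eq_exp_ℝ] at this
    rw [Real.rpow_def_of_pos h, mul_comm]
    refine this.congr_fun fun n => ?_
    rw [mul_pow]; ring
  · simp

theorem kfun_hasSum (a v : ℝ) : HasSum (fun n => a ^ n * ell n v) (kfun a v) := by
  have := (posRPow_hasSum a v).sub (posRPow_hasSum a (v-1))
  refine this.congr_fun fun n => ?_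
  unfold ell; ring

theorem posRPow_scale {h : ℝ} (hh : 0 < h) (u a : ℝ) : posRPow (h * u) a = h ^ a * posRPow u a := by
  unfold posRPow
  by_cases hu : 0 < u
  · rw [if_pos hu, if_pos (by positivity), Real.mul_rpow hh.le hu.le]
  · rw [if_neg hu, if_neg (by rw [mul_pos_iff_of_pos_left hh]; exact hu)]; simp

theorem inc_eq {h : ℝ} (hh : 0 < h) (θ t x : ℝ) :
    fbmKernel θ t x - fbmKernel θ (t - h) x = h ^ (θ - 1/2) * kfun (θ - 1/2) ((t - x)/h) := by
  unfold fbmKernel kfun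
  rw [mul_sub, ← posRPow_scale hh, ← posRPow_scale hh]
  have e1 : h * ((t-x)/h) = t - x := by field_simp
  have e2 : h * ((t-x)/h - 1) = t - h - x := by field_simp; ring
  rw [e1, e2]; ring

def Lfun (n : ℕ) (t h x : ℝ) : ℝ := ell n ((t - x)/h)

theorem memLp_comp_affine {g : ℝ → ℝ} (hm : Measurable g) (hg : MemLp g 2 volume) (t : ℝ) {h : ℝ} (hh : 0 < h) :
    MemLp (fun x => g ((t - x)/h)) 2 volume := by
  have hm' : Measurable (fun x => g ((t - x)/h)) := hm.comp (by fun_prop)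
  rw [memLp_two_iff_integrable_sq hm'.aestronglyMeasurable]
  rw [memLp_two_iff_integrable_sq hm.aestronglyMeasurable] at hg
  exact (hg.comp_div hh.ne').comp_sub_left t

theorem integral_comp_affine (g : ℝ → ℝ) (t : ℝ) {h : ℝ} (hh : 0 < h) :
    ∫ x, g ((t - x)/h) = h * ∫ x, g x := by
  rw [integral_sub_left_eq_self (fun x => g (x/h)) volume t, Measure.integral_comp_div, abs_of_pos hh, smul_eq_mul]

theorem measurable_dom (r : ℝ) : Measurable (dom r) := by
  have h1 : Measurable (dom1 r) := Measurable.indicator (by fun_prop) measurableSet_Ioc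
  have h2 : Measurable (dom2 r) := Measurable.indicator (by fun_prop) measurableSet_Ioi
  exact (h1.add (h1.comp (by fun_prop : Measurable fun v : ℝ => v - 1))).add (h2.comp (by fun_prop : Measurable fun v : ℝ => v - 1))

theorem memLp_ell (n : ℕ) : MemLp (ell n) 2 volume := by
  have h := (memLp_dom (r := 1/4) (by norm_num)).const_mul ((1/4:ℝ)^n)⁻¹
  refine h.mono (measurable_ell n).aestronglyMeasurable (Eventually.of_forall fun v => ?_)
  have := ell_bound (r := 1/4) (by norm_num) (by norm_num) n v
  rw [Real.norm_eq_abs, Real.norm_eq_abs, abs_mul, abs_of_nonneg (by positivity : (0:ℝ) ≤ ((1/4:ℝ)^n)⁻¹), abs_of_nonneg (dom_nonneg _ _),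
    ← div_eq_inv_mul, le_div_iff₀ (by positivity), mul_comm]
  exact this

theorem memLp_Lfun (n : ℕ) (t : ℝ) {h : ℝ} (hh : 0 < h) : MemLp (Lfun n t h) 2 volume :=
  memLp_comp_affine (measurable_ell n) (memLp_ell n) t hh

theorem Lfun_sq_le {r : ℝ} (h0 : 0 < r) (hr : r < 1/2) : ∃ C : ℝ, 0 < C ∧ ∀ (n : ℕ) (t h : ℝ), 0 < h →
    ∫ x, Lfun n t h x ^ 2 ≤ (C * √h * (r ^ n)⁻¹) ^ 2 := by
  have hi : Integrable (fun x => dom r x ^ 2) := (memLp_two_iff_integrable_sq (measurable_dom r).aestronglyMeasurable).1 (memLp_dom hr)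
  refine ⟨√(∫ x, dom r x ^ 2) + 1, by positivity, fun n t h hh => ?_⟩
  unfold Lfun
  rw [integral_comp_affine (fun x => ell n x ^ 2) t hh, mul_pow, mul_pow, Real.sq_sqrt hh.le]
  have h1 : ∫ x, ell n x ^ 2 ≤ ∫ x, dom r x ^ 2 * ((r ^ n)⁻¹)^2 := by
    refine integral_mono ((memLp_two_iff_integrable_sq (measurable_ell n).aestronglyMeasurable).1 (memLp_ell n)) (hi.mul_const _) fun x => ?_
    have := ell_bound h0 hr n x
    simp only
    rw [← mul_pow, ← sq_abs (ell n x), ← div_eq_mul_inv]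
    gcongr
    rw [le_div_iff₀ (by positivity), mul_comm]; exact this
  rw [integral_mul_const] at h1
  have h2 : ∫ x, dom r x ^ 2 ≤ (√(∫ x, dom r x ^ 2) + 1)^2 := by
    have := Real.sq_sqrt (integral_nonneg (fun x => sq_nonneg (dom r x)) : 0 ≤ ∫ x, dom r x ^ 2)
    have h3 := Real.sqrt_nonneg (∫ x, dom r x ^ 2)
    nlinarith
  calc _ ≤ h * ((∫ x, dom r x ^ 2) * ((r ^ n)⁻¹)^2) := by gcongr
    _ ≤ h * ((√(∫ x, dom r x ^ 2) + 1)^2 * ((r ^ n)⁻¹)^2) := by gcongr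
    _ = _ := by ring

theorem partial_bound {r a : ℝ} (h0 : 0 < r) (hr : r < 1/2) (ha : |a| < r) (v : ℝ) (s : Finset ℕ) :
    |∑ n ∈ s, a ^ n * ell n v| ≤ (1 - |a|/r)⁻¹ * dom r v := by
  have hq : |a|/r < 1 := by rwa [div_lt_one h0]
  have hq0 : 0 ≤ |a|/r := by positivity
  calc _ ≤ ∑ n ∈ s, |a ^ n * ell n v| := Finset.abs_sum_le_sum_abs _ _
    _ ≤ ∑ n ∈ s, (|a|/r)^n * dom r v := by
        gcongr with n hn
        rw [abs_mul, abs_pow, div_pow, div_mul_eq_mul_div, mul_div_assoc]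
        gcongr
        rw [le_div_iff₀ (by positivity), mul_comm]; exact ell_bound h0 hr n v
    _ = (∑ n ∈ s, (|a|/r)^n) * dom r v := by rw [Finset.sum_mul]
    _ ≤ _ := by
        gcongr
        · exact dom_nonneg _ _
        · rw [← tsum_geometric_of_lt_one hq0 hq]
          exact (summable_geometric_of_lt_one hq0 hq).sum_le_tsum _ (fun _ _ => by positivity)

theorem exists_between_half {a : ℝ} (ha : |a| < 1/2) : ∃ r, 0 < r ∧ r < 1/2 ∧ |a| < r :=
  ⟨(|a| + 1/2)/2, by positivity, by linarith, by linarith⟩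

theorem kfun_bound {r a : ℝ} (h0 : 0 < r) (hr : r < 1/2) (ha : |a| < r) (v : ℝ) :
    |kfun a v| ≤ (1 - |a|/r)⁻¹ * dom r v :=
  le_of_tendsto ((kfun_hasSum a v).tendsto_sum_nat.abs) (Eventually.of_forall fun N => partial_bound h0 hr ha v _)

theorem memLp_kfun {a : ℝ} (ha : |a| < 1/2) : MemLp (kfun a) 2 volume := by
  obtain ⟨r, h0, hr, har⟩ := exists_between_half ha
  refine ((memLp_dom hr).const_mul ((1 - |a|/r)⁻¹)).mono (measurable_kfun a).aestronglyMeasurable (Eventually.of_forall fun v => ?_)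
  rw [Real.norm_eq_abs, Real.norm_eq_abs]
  exact (kfun_bound h0 hr har v).trans (le_abs_self _)

theorem kfun_L2_lim {a : ℝ} (ha : |a| < 1/2) (t : ℝ) {h : ℝ} (hh : 0 < h) :
    Tendsto (fun N => ∫ x, ((∑ n ∈ Finset.range N, a ^ n * Lfun n t h x) - kfun a ((t-x)/h)) ^ 2) atTop (𝓝 0) := by
  obtain ⟨r, h0, hr, har⟩ := exists_between_half ha
  have e : ∀ N, ∫ x, ((∑ n ∈ Finset.range N, a ^ n * Lfun n t h x) - kfun a ((t-x)/h)) ^ 2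
      = h * ∫ x, ((∑ n ∈ Finset.range N, a ^ n * ell n x) - kfun a x) ^ 2 := fun N =>
    integral_comp_affine (fun x => ((∑ n ∈ Finset.range N, a ^ n * ell n x) - kfun a x) ^ 2) t hh
  simp_rw [e]
  rw [← mul_zero h]
  apply Tendsto.const_mul
  set K := (1 - |a|/r)⁻¹
  have := tendsto_integral_of_dominated_convergence (μ := volume) (F := fun N x => ((∑ n ∈ Finset.range N, a ^ n * ell n x) - kfun a x) ^ 2) (f := fun _ => (0:ℝ))
    (fun x => (2 * K) ^ 2 * dom r x ^ 2) ?_ ?_ ?_ ?_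
  · simpa using this
  · intro N
    apply Measurable.aestronglyMeasurable
    refine ((Finset.measurable_sum _ fun n _ => (measurable_ell n).const_mul _).sub (measurable_kfun a)).pow_const 2
  · exact ((memLp_two_iff_integrable_sq (measurable_dom r).aestronglyMeasurable).1 (memLp_dom hr)).const_mul _
  · intro N
    refine Eventually.of_forall fun v => ?_
    rw [Real.norm_eq_abs, abs_pow, ← mul_pow]
    gcongr
    have h1 := partial_bound h0 hr har v (Finset.range N)
    have h2 := kfun_bound h0 hr har v
    have := abs_sub (∑ n ∈ Finset.range N, a ^ n * ell n v) (kfun a v)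
    simp only [K]; linarith
  · refine Eventually.of_forall fun v => ?_
    have := ((kfun_hasSum a v).tendsto_sum_nat.sub_const (kfun a v)).pow 2
    simpa using this

theorem memLp_inc {θ : ℝ} (hθ : θ ∈ Ioo (0:ℝ) 1) (t : ℝ) {h : ℝ} (hh : 0 < h) :
    MemLp (fun x => fbmKernel θ t x - fbmKernel θ (t - h) x) 2 volume := by
  have ha : |θ - 1/2| < 1/2 := by rw [abs_lt]; constructor <;> linarith [hθ.1, hθ.2]
  simp_rw [inc_eq hh]
  exact (memLp_comp_affine (measurable_kfun _) (memLp_kfun ha) t hh).const_mul _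

theorem fbmKernel_zero (θ : ℝ) : fbmKernel θ 0 = fun _ => 0 := by
  ext x; simp [fbmKernel]

theorem memLp_fbm {θ : ℝ} (hθ : θ ∈ Ioo (0:ℝ) 1) (t : ℝ) : MemLp (fbmKernel θ t) 2 volume := by
  rcases lt_trichotomy t 0 with ht | ht | ht
  · have := (memLp_inc hθ 0 (h := -t) (by linarith)).neg
    refine this.ae_eq (Eventually.of_forall fun x => ?_)
    simp [fbmKernel_zero]
  · subst ht; rw [fbmKernel_zero]; exact MemLp.zero'
  · have := memLp_inc hθ t (h := t) ht
    simpa [fbmKernel_zero] using this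

theorem integral_inc_sq (θ t : ℝ) {h : ℝ} (hh : 0 < h) :
    ∫ x, (fbmKernel θ t x - fbmKernel θ (t - h) x)^2 = h ^ (2 * θ) * ∫ x, kfun (θ - 1/2) x ^ 2 := by
  simp_rw [inc_eq hh, mul_pow]
  rw [integral_const_mul, integral_comp_affine (fun x => kfun (θ - 1/2) x ^ 2) t hh, ← mul_assoc]
  congr 1
  rw [← Real.rpow_mul_natCast hh.le]
  nth_rewrite 2 [← Real.rpow_one h]
  rw [← Real.rpow_add hh]; congr 1; push_cast; ring


/-- dyadic step -/
def hh (j : ℕ) : ℝ := (1/2 : ℝ) ^ j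

theorem hh_pos (j : ℕ) : 0 < hh j := by unfold hh; positivity

/-- the half-half ball -/
abbrev UB : Set ℂ := Metric.ball (1/2 : ℂ) (1/2)

structure GoodW (W : ℕ → ℤ → ℂ → ℂ) : Prop where
  diff : ∀ j k, DifferentiableOn ℂ (W j k) UB
  bound : ∀ r ε M : ℝ, r < 1/2 → 0 < ε → ∃ C : ℝ, 0 < C ∧ ∀ (j : ℕ) (k : ℤ) (z : ℂ), |(k:ℝ)| ≤ M * 2 ^ j →
    ‖z - 1/2‖ ≤ r → ‖W j k z‖ ≤ C * hh j ^ (z.re - ε)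
  cons : ∀ j k, ∀ z ∈ UB, W j k z = W (j+1) (2*k) z + W (j+1) (2*k+1) z

def SS (W : ℕ → ℤ → ℂ → ℂ) (j : ℕ) (k : ℤ) (z : ℂ) : ℂ :=
  ∑ i ∈ Finset.Ico 0 k, W j i z - ∑ i ∈ Finset.Ico k 0, W j i z

theorem SS_zero (W : ℕ → ℤ → ℂ → ℂ) (j : ℕ) (z : ℂ) : SS W j 0 z = 0 := by simp [SS]

theorem SS_succ (W : ℕ → ℤ → ℂ → ℂ) (j : ℕ) (k : ℤ) (z : ℂ) : SS W j (k+1) z = SS W j k z + W j k z := by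
  unfold SS
  rcases le_or_gt 0 k with h | h
  · have e1 : Finset.Ico k 0 = ∅ := Finset.Ico_eq_empty (by omega)
    have e2 : Finset.Ico (k+1) 0 = ∅ := Finset.Ico_eq_empty (by omega)
    have e3 : Finset.Ico 0 (k+1) = insert k (Finset.Ico 0 k) := by ext i; simp; omega
    rw [e1, e2, e3, Finset.sum_insert (by simp)]; simp; ring
  · have e1 : Finset.Ico 0 k = ∅ := Finset.Ico_eq_empty (by omega)
    have e2 : Finset.Ico 0 (k+1) = ∅ := Finset.Ico_eq_empty (by omega)
    have e3 : Finset.Ico k 0 = insert k (Finset.Ico (k+1) 0) := by ext i; simp; omega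
    rw [e1, e2, e3, Finset.sum_insert (by simp)]; simp

def FFj (W : ℕ → ℤ → ℂ → ℂ) (j : ℕ) (t : ℝ) (z : ℂ) : ℂ := SS W j ⌊2 ^ j * t⌋ z

def FF (W : ℕ → ℤ → ℂ → ℂ) (t : ℝ) (z : ℂ) : ℂ := limUnder atTop (fun j => FFj W j t z)

namespace GoodW
variable {W : ℕ → ℤ → ℂ → ℂ}

theorem SS_double (h : GoodW W) (j : ℕ) (k : ℤ) {z : ℂ} (hz : z ∈ UB) : SS W (j+1) (2*k) z = SS W j k z := by
  have step : ∀ k : ℤ, SS W (j+1) (2*(k+1)) z = SS W (j+1) (2*k) z + W j k z := by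
    intro k
    have : (2 * (k+1) : ℤ) = 2*k+1+1 := by ring
    rw [this, SS_succ, SS_succ, h.cons j k z hz]; ring
  induction k using Int.induction_on with
  | zero => simp [SS_zero]
  | succ i ih => rw [step, SS_succ, ih]
  | pred i ih =>
    have h1 := step (-(i:ℤ) - 1)
    have h2 := SS_succ W j (-(i:ℤ) - 1) z
    rw [sub_add_cancel] at h1 h2
    rw [ih, h2] at h1
    exact (add_right_cancel h1).symm

theorem SS_pow (h : GoodW W) (j i : ℕ) (k : ℤ) {z : ℂ} (hz : z ∈ UB) : SS W (j+i) (2^i*k) z = SS W j k z := by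
  induction i with
  | zero => simp
  | succ i ih => rw [← ih, ← add_assoc, pow_succ', mul_assoc, h.SS_double _ _ hz]

theorem diff_FFj (h : GoodW W) (j : ℕ) (t : ℝ) : DifferentiableOn ℂ (FFj W j t) UB := by
  unfold FFj SS
  exact (DifferentiableOn.fun_sum fun i _ => h.diff j i).sub (DifferentiableOn.fun_sum fun i _ => h.diff j i)

theorem step_bound (h : GoodW W) {r ε M : ℝ} (hr : r < 1/2) (hε : 0 < ε) (hM : 0 < M) :
    ∃ C : ℝ, 0 < C ∧ (∀ (j : ℕ) (t : ℝ) (z : ℂ), |t| ≤ M → ‖z - 1/2‖ ≤ r →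
      ‖FFj W (j+1) t z - FFj W j t z‖ ≤ C * hh (j+1) ^ (z.re - ε)) ∧
      (∀ (j : ℕ) (t s : ℝ) (z : ℂ), |t| ≤ M → |s| ≤ M → |t - s| ≤ hh j → ‖z - 1/2‖ ≤ r →
      ‖FFj W j t z - FFj W j s z‖ ≤ C * hh j ^ (z.re - ε)) := by
  obtain ⟨C, hC, hb⟩ := h.bound r ε (M+1) hr hε
  have hfl : ∀ (j : ℕ) (t : ℝ), |t| ≤ M → |((⌊2 ^ j * t⌋ : ℤ) : ℝ)| ≤ M * 2 ^ j + 1 := by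
    intro j t ht
    have h1 := Int.floor_le ((2:ℝ) ^ j * t)
    have h2 := Int.lt_floor_add_one ((2:ℝ) ^ j * t)
    have h3 : |(2:ℝ) ^ j * t| ≤ M * 2 ^ j := by
      rw [abs_mul, abs_of_pos (by positivity), mul_comm]; gcongr
    rw [abs_le] at h3 ⊢
    constructor <;> linarith
  have hp : ∀ j : ℕ, (1:ℝ) ≤ 2 ^ j := fun j => one_le_pow₀ (by norm_num)
  refine ⟨C, hC, ?_, ?_⟩
  · intro j t z ht hz
    have hzU : z ∈ UB := by rw [Metric.mem_ball, dist_eq_norm]; linarith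
    unfold FFj
    rw [← h.SS_double j _ hzU]
    have h1 := Int.floor_le ((2:ℝ) ^ j * t)
    have h2 := Int.lt_floor_add_one ((2:ℝ) ^ j * t)
    have hcase : ⌊(2:ℝ)^(j+1) * t⌋ = 2 * ⌊(2:ℝ)^j * t⌋ ∨ ⌊(2:ℝ)^(j+1) * t⌋ = 2 * ⌊(2:ℝ)^j * t⌋ + 1 := by
      have e : (2:ℝ)^(j+1) * t = 2 * (2^j * t) := by ring
      rw [e]
      rcases lt_or_ge ((2:ℝ)^j * t) (⌊(2:ℝ)^j * t⌋ + 1/2) with h3 | h3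
      · left; rw [Int.floor_eq_iff]; push_cast; constructor <;> linarith
      · right; rw [Int.floor_eq_iff]; push_cast; constructor <;> linarith
    rcases hcase with e | e
    · rw [e, sub_self, norm_zero]
      have := hh_pos (j+1); positivity
    · rw [e, SS_succ, add_sub_cancel_left]
      apply hb _ _ _ _ hz
      have h3 := hfl j t ht
      push_cast
      rw [abs_mul, abs_two, pow_succ]
      nlinarith [hp j]
  · intro j t s z ht hs hts hz
    unfold FFj
    wlog hle : t ≤ s generalizing t s
    · rw [norm_sub_rev]
      exact this s t hs ht (by rw [abs_sub_comm]; exact hts) (le_of_not_ge hle)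
    have h1 := Int.floor_le ((2:ℝ) ^ j * t)
    have h2 := Int.lt_floor_add_one ((2:ℝ) ^ j * t)
    have h3 : (2:ℝ)^j * s ≤ 2^j * t + 1 := by
      rw [abs_sub_comm, abs_of_nonneg (by linarith)] at hts
      have : (2:ℝ)^j * (s - t) ≤ 2^j * hh j := by gcongr
      have e : (2:ℝ)^j * hh j = 1 := by unfold hh; rw [← mul_pow]; norm_num
      linarith
    have hmono : ⌊(2:ℝ)^j * t⌋ ≤ ⌊(2:ℝ)^j * s⌋ := Int.floor_le_floor (by gcongr)
    have hup : ⌊(2:ℝ)^j * s⌋ ≤ ⌊(2:ℝ)^j * t⌋ + 1 := by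
      rw [← Int.floor_add_one]; exact Int.floor_le_floor h3
    have hcase : ⌊(2:ℝ)^j * s⌋ = ⌊(2:ℝ)^j * t⌋ ∨ ⌊(2:ℝ)^j * s⌋ = ⌊(2:ℝ)^j * t⌋ + 1 := by omega
    rcases hcase with e | e
    · rw [e, sub_self, norm_zero]
      have := hh_pos j; positivity
    · rw [e, SS_succ, sub_add_cancel_left, norm_neg]
      apply hb _ _ _ _ hz
      have := hfl j t ht
      nlinarith [hp j]

theorem hh_rpow (j : ℕ) (x : ℝ) : hh j ^ x = ((1/2:ℝ) ^ x) ^ j := by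
  unfold hh
  rw [← Real.rpow_natCast_mul (by norm_num), ← Real.rpow_mul_natCast (by norm_num), mul_comm]

theorem re_lower {z : ℂ} {r : ℝ} (hz : ‖z - 1/2‖ ≤ r) : 1/2 - r ≤ z.re ∧ z.re ≤ 1/2 + r := by
  have := (Complex.abs_re_le_norm (z - 1/2)).trans hz
  have e : (z - 1/2).re = z.re - 1/2 := by simp
  rw [e, abs_le] at this
  constructor <;> linarith

theorem FF_approx (h : GoodW W) {r ε M : ℝ} (hr : r < 1/2) (hε : 0 < ε) (hεr : ε < 1/2 - r) (hM : 0 < M) :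
    ∃ C : ℝ, 0 < C ∧ (∀ (j : ℕ) (t : ℝ) (z : ℂ), |t| ≤ M → ‖z - 1/2‖ ≤ r →
      Tendsto (fun j => FFj W j t z) atTop (𝓝 (FF W t z)) ∧
      ‖FF W t z - FFj W j t z‖ ≤ C * hh j ^ (z.re - ε)) ∧
      (∀ (j : ℕ) (t s : ℝ) (z : ℂ), |t| ≤ M → |s| ≤ M → |t - s| ≤ hh j → ‖z - 1/2‖ ≤ r →
      ‖FFj W j t z - FFj W j s z‖ ≤ C * hh j ^ (z.re - ε)) := by
  obtain ⟨C, hC, h1, h2⟩ := h.step_bound hr hε hM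
  set γ := 1/2 - r - ε with hγ
  have hγ0 : 0 < γ := by linarith
  have hq1 : (1/2:ℝ) ^ γ < 1 := Real.rpow_lt_one (by norm_num) (by norm_num) hγ0
  have hinv : 1 ≤ (1 - (1/2:ℝ)^γ)⁻¹ := by
    rw [one_le_inv₀ (by linarith)]
    have : (0:ℝ) < (1/2:ℝ) ^ γ := by positivity
    linarith
  refine ⟨C * (1 - (1/2:ℝ)^γ)⁻¹, mul_pos hC (by linarith), ?_, ?_⟩
  · intro j t z ht hz
    set x := z.re - ε with hx
    have hxγ : γ ≤ x := by have := (re_lower hz).1; linarith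
    have hqx : (1/2:ℝ) ^ x ≤ (1/2:ℝ) ^ γ := Real.rpow_le_rpow_of_exponent_ge (by norm_num) (by norm_num) hxγ
    have hq0 : (0:ℝ) < (1/2:ℝ) ^ x := by positivity
    have hd : ∀ n, dist (FFj W n t z) (FFj W (n+1) t z) ≤ C * ((1/2:ℝ)^x)^n := by
      intro n
      rw [dist_comm, dist_eq_norm]
      refine (h1 n t z ht hz).trans ?_
      rw [hh_rpow, pow_succ]
      gcongr
      exact mul_le_of_le_one_right (by positivity) (by linarith)
    have hcs := cauchySeq_of_le_geometric _ _ (by linarith : (1/2:ℝ)^x < 1) hd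
    have hlim : Tendsto (fun j => FFj W j t z) atTop (𝓝 (FF W t z)) := hcs.tendsto_limUnder
    refine ⟨hlim, ?_⟩
    have := dist_le_of_le_geometric_of_tendsto _ _ (by linarith : (1/2:ℝ)^x < 1) hd hlim j
    rw [dist_comm, dist_eq_norm] at this
    refine this.trans ?_
    rw [hh_rpow, mul_assoc, mul_comm (_⁻¹), ← mul_assoc, ← div_eq_mul_inv]
    have : 0 < 1 - (1/2:ℝ)^γ := by linarith
    gcongr
  · intro j t s z ht hs hts hz
    refine (h2 j t s z ht hs hts hz).trans ?_
    have := hh_pos j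
    have h3 : C * 1 ≤ C * (1 - (1/2:ℝ)^γ)⁻¹ := by gcongr
    rw [mul_one] at h3
    gcongr

theorem FF_holder (h : GoodW W) {r ε M : ℝ} (hr : r < 1/2) (hε : 0 < ε) (hεr : ε < 1/2 - r) (hM : 0 < M) :
    ∃ C : ℝ, 0 < C ∧ ∀ (t s : ℝ) (z : ℂ), |t| ≤ M → |s| ≤ M → ‖z - 1/2‖ ≤ r →
      ‖FF W t z - FF W s z‖ ≤ C * |t - s| ^ (z.re - ε) := by
  obtain ⟨C, hC, h1, h2⟩ := h.FF_approx hr hε hεr hM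
  have small : ∀ (t s : ℝ) (z : ℂ), |t| ≤ M → |s| ≤ M → ‖z - 1/2‖ ≤ r → |t - s| ≤ 1 →
      ‖FF W t z - FF W s z‖ ≤ 6 * C * |t - s| ^ (z.re - ε) := by
    intro t s z ht hs hz hts
    rcases eq_or_ne t s with rfl | hne
    · rw [sub_self, norm_zero]; positivity
    have hpos : 0 < |t - s| := abs_pos.2 (sub_ne_zero.2 hne)
    obtain ⟨j, hj1, hj2⟩ := exists_nat_pow_near_of_lt_one hpos hts (by norm_num : (0:ℝ) < 1/2) (by norm_num)
    have a1 := (h1 j t z ht hz).2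
    have a2 := (h1 j s z hs hz).2
    have a3 := h2 j t s z ht hs hj2 hz
    have hre := re_lower hz
    have b : hh j ^ (z.re - ε) ≤ 2 * |t - s| ^ (z.re - ε) := by
      have : hh j ≤ 2 * |t - s| := by unfold hh; rw [pow_succ] at hj1; linarith
      calc hh j ^ (z.re - ε) ≤ (2 * |t-s|) ^ (z.re - ε) := Real.rpow_le_rpow (hh_pos j).le this (by linarith)
        _ = 2 ^ (z.re - ε) * |t-s| ^ (z.re - ε) := Real.mul_rpow (by norm_num) hpos.le
        _ ≤ 2 ^ (1:ℝ) * |t-s| ^ (z.re - ε) := by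
            gcongr
            · norm_num
            · linarith
        _ = _ := by rw [Real.rpow_one]
    have e : FF W t z - FF W s z = (FF W t z - FFj W j t z) - (FF W s z - FFj W j s z) + (FFj W j t z - FFj W j s z) := by ring
    rw [e]
    refine (norm_add_le _ _).trans ?_
    have := norm_sub_le (FF W t z - FFj W j t z) (FF W s z - FFj W j s z)
    nlinarith
  obtain ⟨N, hN⟩ := exists_nat_ge (2 * M + 1)
  have hN0 : (0:ℝ) < N := by linarith
  refine ⟨N * (6 * C), by positivity, ?_⟩
  intro t s z ht hs hz
  have hre := re_lower hz
  set p : ℕ → ℝ := fun i => s + (i / N) * (t - s) with hp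
  have hst : |t - s| ≤ 2 * M := by have := abs_sub t s; linarith
  have hpM : ∀ i ≤ N, |p i| ≤ M := by
    intro i hi
    have h0 : (0:ℝ) ≤ i / N := by positivity
    have h1 : (i:ℝ) / N ≤ 1 := by rw [div_le_one hN0]; exact_mod_cast hi
    simp only [hp]
    have e : s + i / N * (t - s) = (1 - i/N) * s + (i/N) * t := by ring
    rw [e]
    rw [abs_le] at *
    constructor <;> nlinarith
  have hd : ∀ i, p (i+1) - p i = (t - s) / N := by intro i; simp only [hp]; push_cast; ring
  have key := dist_le_range_sum_dist (fun i => FF W (p i) z) N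
  have e0 : p 0 = s := by simp [hp]
  have eN : p N = t := by simp only [hp]; rw [div_self hN0.ne']; ring
  simp only [e0, eN] at key
  rw [dist_comm, dist_eq_norm] at key
  refine key.trans ?_
  have : ∀ i ∈ Finset.range N, dist (FF W (p i) z) (FF W (p (i+1)) z) ≤ 6 * C * |t - s| ^ (z.re - ε) := by
    intro i hi
    rw [Finset.mem_range] at hi
    have e : |p (i+1) - p i| ≤ |t - s| := by
      rw [hd, abs_div, Nat.abs_cast]
      exact div_le_self (abs_nonneg _) (by linarith)
    have e' : |p (i+1) - p i| ≤ 1 := by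
      rw [hd, abs_div, Nat.abs_cast, div_le_one hN0]; linarith
    rw [dist_comm, dist_eq_norm]
    refine (small _ _ z (hpM _ (by omega)) (hpM _ (by omega)) hz e').trans ?_
    gcongr
    linarith
  refine (Finset.sum_le_sum this).trans ?_
  simp; apply le_of_eq; ring

theorem FF_dyadic (h : GoodW W) (j : ℕ) (k : ℤ) {z : ℂ} (hz : z ∈ UB) : FF W (k / 2 ^ j) z = SS W j k z := by
  unfold FF
  apply Tendsto.limUnder_eq
  apply tendsto_const_nhds.congr'
  filter_upwards [eventually_ge_atTop j] with i hi
  obtain ⟨i, rfl⟩ := Nat.exists_eq_add_of_le hi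
  unfold FFj
  have : (2:ℝ) ^ (j+i) * (k / 2 ^ j) = ((2 ^ i * k : ℤ) : ℝ) := by
    push_cast; rw [pow_add]; field_simp
  rw [this, Int.floor_intCast, h.SS_pow _ _ _ hz]

theorem FF_zero (h : GoodW W) {z : ℂ} (hz : z ∈ UB) : FF W 0 z = 0 := by
  have := h.FF_dyadic 0 0 hz
  simpa [SS_zero] using this

theorem FF_diff (h : GoodW W) (t : ℝ) : DifferentiableOn ℂ (FF W t) UB := by
  have : TendstoLocallyUniformlyOn (fun j => FFj W j t) (FF W t) atTop UB := by
    rw [Metric.tendstoLocallyUniformlyOn_iff]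
    intro e he z hz
    have hz' : ‖z - 1/2‖ < 1/2 := by rwa [Metric.mem_ball, dist_eq_norm] at hz
    set r := (‖z - 1/2‖ + 1/2)/2 with hr
    have hr2 : r < 1/2 := by rw [hr]; linarith
    obtain ⟨C, hC, h1, h2⟩ := h.FF_approx (r := r) (ε := (1/2 - r)/2) (M := |t| + 1) hr2 (by linarith) (by linarith) (by positivity)
    refine ⟨Metric.closedBall (1/2) r, mem_nhdsWithin_of_mem_nhds (Metric.closedBall_mem_nhds_of_mem ?_), ?_⟩
    · rw [Metric.mem_ball, dist_eq_norm]; linarith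
    · have hlim : Tendsto (fun j => C * ((1/2:ℝ) ^ ((1/2 - r)/2))^j) atTop (𝓝 (C * 0)) :=
        (tendsto_pow_atTop_nhds_zero_of_lt_one (by positivity) (Real.rpow_lt_one (by norm_num) (by norm_num) (by linarith))).const_mul C
      rw [mul_zero] at hlim
      filter_upwards [hlim.eventually (gt_mem_nhds he)] with j hj w hw
      rw [Metric.mem_closedBall, dist_eq_norm] at hw
      rw [dist_eq_norm]
      refine lt_of_le_of_lt (h1 j t w (by linarith) hw).2 (lt_of_le_of_lt ?_ hj)
      rw [← hh_rpow]
      have := (re_lower hw).1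
      apply mul_le_mul_of_nonneg_left _ hC.le
      exact Real.rpow_le_rpow_of_exponent_ge (hh_pos j) (pow_le_one₀ (by norm_num) (by norm_num)) (by linarith)
  exact this.differentiableOn (Eventually.of_forall fun j => h.diff_FFj j t) Metric.isOpen_ball

end GoodW


def rho (m : ℕ) : ℝ := 1/2 - 1/((m:ℝ)+3)

theorem rho_pos (m : ℕ) : 0 < rho m := by
  unfold rho
  have : 1/((m:ℝ)+3) ≤ 1/3 := by gcongr; linarith [(Nat.cast_nonneg m : (0:ℝ) ≤ m)]
  linarith
theorem rho_lt (m : ℕ) : rho m < 1/2 := by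
  unfold rho
  have : 0 < 1/((m:ℝ)+3) := by positivity
  linarith

def Wx (x : ℕ → ℤ → ℕ → ℝ) (j : ℕ) (k : ℤ) (z : ℂ) : ℂ :=
  ((hh j : ℝ) : ℂ) ^ (z - 1/2) * ∑' n, (z - 1/2) ^ n * (x j k n : ℂ)

def wt (j : ℕ) (k : ℤ) (n : ℕ) : ℝ := ((n:ℝ)+1) * (|(k:ℝ)|+1) * ((j:ℝ)+1)

structure GoodX (x : ℕ → ℤ → ℕ → ℝ) : Prop where
  e1 : ∀ m : ℕ, ∃ C : ℝ, 0 < C ∧ ∀ j k n, |x j k n| ≤ C * (√(hh j) * (rho m ^ n)⁻¹ * wt j k n ^ (1/((m:ℝ)+1)))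
  e2 : ∀ j k (q : ℚ), (q : ℝ) ∈ Ioo (0:ℝ) 1 → Wx x j k ((q:ℝ):ℂ) = Wx x (j+1) (2*k) ((q:ℝ):ℂ) + Wx x (j+1) (2*k+1) ((q:ℝ):ℂ)

namespace GoodX
variable {x : ℕ → ℤ → ℕ → ℝ}

theorem coef (e1 : ∀ m : ℕ, ∃ C : ℝ, 0 < C ∧ ∀ j k n, |x j k n| ≤ C * (√(hh j) * (rho m ^ n)⁻¹ * wt j k n ^ (1/((m:ℝ)+1))))
    {r ε : ℝ} (hr0 : 0 ≤ r) (hr : r < 1/2) (hε : 0 < ε) :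
    ∃ u : ℕ → ℝ, Summable u ∧ (∀ n, 0 ≤ u n) ∧ ∀ j k n, r ^ n * |x j k n| ≤
      √(hh j) * ((|(k:ℝ)|+1) * ((j:ℝ)+1)) ^ ε * u n := by
  obtain ⟨m, hm⟩ := exists_nat_ge (1/(1/2-r) + 1/ε)
  obtain ⟨C, hC, hb⟩ := e1 m
  have hd : 0 < 1/2 - r := by linarith
  have p1 : 0 < 1/(1/2-r) := by positivity
  have p2 : 0 < 1/ε := by positivity
  have hrm : r < rho m := by
    unfold rho
    have : 1/((m:ℝ)+3) < 1/2 - r := by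
      rw [one_div_lt (by positivity) hd]; linarith
    linarith
  have hδ : 1/((m:ℝ)+1) ≤ ε := by
    rw [one_div_le (by positivity) hε]; linarith
  have hδ1 : 1/((m:ℝ)+1) ≤ 1 := by
    rw [div_le_one (by positivity)]; linarith [(Nat.cast_nonneg m : (0:ℝ) ≤ m)]
  have hρ := rho_pos m
  set q := r / rho m with hq
  have hq0 : 0 ≤ q := by positivity
  have hq1 : q < 1 := by rw [hq, div_lt_one hρ]; exact hrm
  refine ⟨fun n => C * (((n:ℝ)+1) * q ^ n), ?_, fun n => by positivity, ?_⟩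
  · apply Summable.mul_left
    have h1 := summable_pow_mul_geometric_of_norm_lt_one 1 (r := q) (by rwa [Real.norm_eq_abs, abs_of_nonneg hq0])
    have h2 := summable_geometric_of_lt_one hq0 hq1
    refine (h1.add h2).congr fun n => ?_
    ring
  · intro j k n
    have hh0 := hh_pos j
    have hk1 : 1 ≤ (|(k:ℝ)|+1) * ((j:ℝ)+1) := by
      have := abs_nonneg (k:ℝ)
      have : (0:ℝ) ≤ j := by positivity
      nlinarith
    have hw : wt j k n ^ (1/((m:ℝ)+1)) ≤ ((n:ℝ)+1) * ((|(k:ℝ)|+1) * ((j:ℝ)+1)) ^ ε := by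
      unfold wt
      rw [mul_assoc, Real.mul_rpow (by positivity) (by positivity)]
      gcongr
      · nth_rewrite 2 [← Real.rpow_one ((n:ℝ)+1)]
        exact Real.rpow_le_rpow_of_exponent_le (by linarith [(Nat.cast_nonneg n : (0:ℝ) ≤ n)]) hδ1
    calc r ^ n * |x j k n| ≤ r ^ n * (C * (√(hh j) * (rho m ^ n)⁻¹ * wt j k n ^ (1/((m:ℝ)+1)))) := by
          gcongr; exact hb j k n
      _ ≤ r ^ n * (C * (√(hh j) * (rho m ^ n)⁻¹ * (((n:ℝ)+1) * ((|(k:ℝ)|+1) * ((j:ℝ)+1)) ^ ε))) := by gcongr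
      _ = _ := by simp only [hq, div_pow]; ring

theorem summable_coef (e1 : ∀ m : ℕ, ∃ C : ℝ, 0 < C ∧ ∀ j k n, |x j k n| ≤ C * (√(hh j) * (rho m ^ n)⁻¹ * wt j k n ^ (1/((m:ℝ)+1))))
    (j : ℕ) (k : ℤ) {z : ℂ} (hz : z ∈ UB) : Summable fun n => (z - 1/2) ^ n * (x j k n : ℂ) := by
  rw [Metric.mem_ball, dist_eq_norm] at hz
  obtain ⟨u, hu, hu0, hb⟩ := coef e1 (norm_nonneg (z - 1/2)) hz one_pos
  refine Summable.of_norm_bounded (hu.mul_left (√(hh j) * ((|(k:ℝ)|+1) * ((j:ℝ)+1)) ^ (1:ℝ))) fun n => ?_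
  rw [norm_mul, norm_pow, Complex.norm_real, Real.norm_eq_abs]
  exact hb j k n

theorem goodW (h : GoodX x) : GoodW (Wx x) := by
  have hdiff : ∀ j k, DifferentiableOn ℂ (Wx x j k) UB := by
    intro j k z hz
    have hz' : ‖z - 1/2‖ < 1/2 := by rwa [Metric.mem_ball, dist_eq_norm] at hz
    set r := (‖z - 1/2‖ + 1/2)/2 with hr
    have hr2 : r < 1/2 := by rw [hr]; linarith
    have hr0 : 0 ≤ r := by positivity
    obtain ⟨u, hu, hu0, hb⟩ := coef h.e1 hr0 hr2 one_pos
    apply DifferentiableAt.differentiableWithinAt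
    unfold Wx
    apply DifferentiableAt.mul
    · apply DifferentiableAt.const_cpow (by fun_prop)
      left; exact_mod_cast (hh_pos j).ne'
    · have := Complex.differentiableOn_tsum_of_summable_norm (F := fun n (z:ℂ) => (z - 1/2) ^ n * (x j k n : ℂ))
        (U := Metric.ball (1/2) r) (hu.mul_left (√(hh j) * ((|(k:ℝ)|+1) * ((j:ℝ)+1)) ^ (1:ℝ)))
        (fun n => by fun_prop) Metric.isOpen_ball (fun n w hw => ?_)
      · exact this.differentiableAt (Metric.isOpen_ball.mem_nhds (by rw [Metric.mem_ball, dist_eq_norm]; linarith))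
      · rw [Metric.mem_ball, dist_eq_norm] at hw
        rw [norm_mul, norm_pow, Complex.norm_real, Real.norm_eq_abs]
        refine le_trans ?_ (hb j k n)
        gcongr
  refine ⟨hdiff, ?_, ?_⟩
  · intro r ε M hr hε
    rcases lt_or_ge r 0 with hr0 | hr0
    · exact ⟨1, one_pos, fun j k z _ hz => absurd (hz.trans_lt hr0) (not_lt.2 (norm_nonneg _))⟩
    obtain ⟨u, hu, hu0, hb⟩ := coef h.e1 hr0 hr (half_pos hε)
    have hU : 0 ≤ ∑' n, u n := tsum_nonneg hu0
    refine ⟨(|M|+1)^(ε/2) * (∑' n, u n + 1), by positivity, ?_⟩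
    intro j k z hk hz
    have h0 := hh_pos j
    unfold Wx
    rw [norm_mul, Complex.norm_cpow_eq_rpow_re_of_pos h0]
    have hsum : ‖∑' n, (z - 1/2) ^ n * (x j k n : ℂ)‖ ≤ √(hh j) * ((|(k:ℝ)|+1) * ((j:ℝ)+1)) ^ (ε/2) * ∑' n, u n := by
      rw [← tsum_mul_left]
      refine tsum_of_norm_bounded ((hu.mul_left _).hasSum) fun n => ?_
      rw [norm_mul, norm_pow, Complex.norm_real, Real.norm_eq_abs]
      refine le_trans ?_ (hb j k n)
      gcongr
    have hkj : (|(k:ℝ)|+1) * ((j:ℝ)+1) ≤ (|M|+1) * hh j ^ (-2:ℝ) := by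
      have e : hh j ^ (-2:ℝ) = 2^j * 2^j := by
        unfold hh
        rw [Real.rpow_neg (by positivity), ← Nat.cast_two, Real.rpow_natCast]
        rw [one_div, inv_pow, inv_pow, inv_inv, sq, Nat.cast_two]
      rw [e, ← mul_assoc]
      have h1 : (j:ℝ)+1 ≤ 2^j := by exact_mod_cast Nat.lt_two_pow_self
      have h2 : (1:ℝ) ≤ 2^j := one_le_pow₀ (by norm_num)
      have h3 : |(k:ℝ)|+1 ≤ (|M|+1) * 2^j := by
        have : M * 2^j ≤ |M| * 2^j := by gcongr; exact le_abs_self M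
        linarith
      gcongr
    have hpow : ((|(k:ℝ)|+1) * ((j:ℝ)+1)) ^ (ε/2) ≤ (|M|+1)^(ε/2) * hh j ^ (-ε) := by
      calc _ ≤ ((|M|+1) * hh j ^ (-2:ℝ)) ^ (ε/2) := Real.rpow_le_rpow (by positivity) hkj (by positivity)
        _ = _ := by
          rw [Real.mul_rpow (by positivity) (by positivity), ← Real.rpow_mul h0.le]
          congr 2; ring
    have e : (z - 1/2).re = z.re - 1/2 := by simp
    rw [e]
    calc _ ≤ hh j ^ (z.re - 1/2) * (√(hh j) * ((|M|+1)^(ε/2) * hh j ^ (-ε)) * (∑' n, u n + 1)) := by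
          refine mul_le_mul_of_nonneg_left (hsum.trans ?_) (by positivity)
          gcongr; linarith
      _ = (|M|+1)^(ε/2) * (∑' n, u n + 1) * (hh j ^ (z.re - 1/2) * √(hh j) * hh j ^ (-ε)) := by ring
      _ = _ := by
          rw [Real.sqrt_eq_rpow, ← Real.rpow_add h0, ← Real.rpow_add h0]; congr 2; ring
  · intro j k
    have hpre : IsPreconnected UB := (convex_ball _ _).isPreconnected
    have an : ∀ j k, AnalyticOnNhd ℂ (Wx x j k) UB := fun j k => (hdiff j k).analyticOnNhd Metric.isOpen_ball
    have hU : (1/2:ℂ) ∈ UB := Metric.mem_ball_self (by norm_num)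
    refine (an j k).eqOn_of_preconnected_of_frequently_eq ((an (j+1) (2*k)).add (an (j+1) (2*k+1))) hpre hU ?_
    have ht : Tendsto (fun n : ℕ => (((((1/2 + 1/((n:ℚ)+3) : ℚ)) : ℝ)) : ℂ)) atTop (𝓝[≠] (1/2)) := by
      rw [tendsto_nhdsWithin_iff]
      constructor
      · have : Tendsto (fun n : ℕ => (1/2:ℝ) + 1/((n:ℝ)+3)) atTop (𝓝 (1/2 + 0)) := by
          refine tendsto_const_nhds.add ?_
          have := (tendsto_one_div_add_atTop_nhds_zero_nat (𝕜 := ℝ)).comp (tendsto_add_atTop_nat 2)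
          refine this.congr fun n => ?_
          simp only [Function.comp]; push_cast; ring
        have := (Complex.continuous_ofReal.tendsto _).comp this
        simp only [Function.comp_def] at this
        convert this using 2
        · push_cast; rfl
        · simp
      · refine Eventually.of_forall fun n => ?_
        simp only [mem_compl_iff, mem_singleton_iff]
        intro hc
        have h3 : (0:ℝ) < 1/((n:ℝ)+3) := by positivity
        have h4 : ((1/2 + 1/((n:ℚ)+3) : ℚ) : ℝ) = 1/2 := by
          have : (1/2 : ℂ) = ((1/2:ℝ):ℂ) := by simp
          rw [this] at hc
          exact_mod_cast hc
        push_cast at h4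
        linarith
    refine ht.frequently (Eventually.frequently (Eventually.of_forall fun n => ?_))
    refine h.e2 j k _ ?_
    have h3 : (0:ℝ) < 1/((n:ℝ)+3) := by positivity
    have h4 : 1/((n:ℝ)+3) ≤ 1/3 := by gcongr; linarith [(Nat.cast_nonneg n : (0:ℝ) ≤ n)]
    push_cast
    constructor <;> linarith

end GoodX

/-- the random coefficients -/
def xc {Ω : Type} (X : (ℝ → ℝ) → Ω → ℝ) (ω : Ω) (j : ℕ) (k : ℤ) (n : ℕ) : ℝ :=
  X (Lfun n (((k:ℝ)+1)/2^j) (hh j)) ω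

theorem real_mem_UB {θ : ℝ} (hθ : θ ∈ Ioo (0:ℝ) 1) : (θ : ℂ) ∈ UB := by
  rw [Metric.mem_ball, dist_eq_norm]
  have : (θ : ℂ) - 1/2 = ((θ - 1/2 : ℝ) : ℂ) := by push_cast; rfl
  rw [this, Complex.norm_real, Real.norm_eq_abs, abs_lt]
  constructor <;> linarith [hθ.1, hθ.2]

namespace IsoProc
variable {Ω : Type} {mΩ : MeasurableSpace Ω} {P : Measure Ω} {X : (ℝ → ℝ) → Ω → ℝ}

theorem ae_e1 (h : IsoProc P X) : ∀ᵐ ω ∂P, ∀ m : ℕ, ∃ C : ℝ, 0 < C ∧ ∀ j k n,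
    |xc X ω j k n| ≤ C * (√(hh j) * (rho m ^ n)⁻¹ * wt j k n ^ (1/((m:ℝ)+1))) := by
  rw [ae_all_iff]
  intro m
  obtain ⟨C, hC, hb⟩ := Lfun_sq_le (rho_pos m) (rho_lt m)
  have hw : ∀ j k n, 0 < wt j k n := fun j k n => by unfold wt; positivity
  have hρ := rho_pos m
  have := h.ae_bound (ι := ℕ × ℤ × ℕ) (fun i => Lfun i.2.2 (((i.2.1:ℝ)+1)/2^i.1) (hh i.1))
    (fun i => C * √(hh i.1) * (rho m ^ i.2.2)⁻¹) (fun i => wt i.1 i.2.1 i.2.2 ^ (1/((m:ℝ)+1)))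
    (fun i => memLp_Lfun _ _ (hh_pos _)) (fun i => by have := hh_pos i.1; positivity)
    (fun i => hb _ _ _ (hh_pos _)) (fun i => by have := hw i.1 i.2.1 i.2.2; positivity) (2*(m+1)) ?_
  · filter_upwards [this] with ω ⟨K, hK, hω⟩
    refine ⟨K * C, by positivity, fun j k n => (hω (j,k,n)).trans (le_of_eq ?_)⟩
    ring
  · refine (summable_index 2 le_rfl).congr fun i => ?_
    have := hw i.1 i.2.1 i.2.2
    rw [← Real.rpow_mul_natCast this.le]
    have e : 1/((m:ℝ)+1) * ((2*(m+1) : ℕ) : ℝ) = (2:ℕ) := by push_cast; field_simp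
    rw [e, Real.rpow_natCast]; rfl

theorem W_eq (h : IsoProc P X) {θ : ℝ} (hθ : θ ∈ Ioo (0:ℝ) 1) (j : ℕ) (k : ℤ) :
    ∀ᵐ ω ∂P, Wx (xc X ω) j k (θ : ℂ) =
      (X (fun x => fbmKernel θ (((k:ℝ)+1)/2^j) x - fbmKernel θ ((k:ℝ)/2^j) x) ω : ℂ) := by
  have ha : |θ - 1/2| < 1/2 := by rw [abs_lt]; constructor <;> linarith [hθ.1, hθ.2]
  set a := θ - 1/2 with haa
  set t := ((k:ℝ)+1)/2^j with ht
  have h0 := hh_pos j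
  have hs : (k:ℝ)/2^j = t - hh j := by rw [ht, hh, one_div, inv_pow]; field_simp; ring
  have hk := memLp_comp_affine (measurable_kfun a) (memLp_kfun ha) t h0
  have hf : ∀ N, MemLp (fun x => ∑ n ∈ Finset.range N, a ^ n * Lfun n t (hh j) x) 2 volume := fun N =>
    memLp_finsetSum _ fun n _ => (memLp_Lfun n t h0).const_mul _
  have hsum : ∀ᵐ ω ∂P, ∀ N, X (fun x => ∑ n ∈ Finset.range N, a ^ n * Lfun n t (hh j) x) ω
      = ∑ n ∈ Finset.range N, a ^ n * xc X ω j k n := by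
    rw [ae_all_iff]; intro N
    exact h.sum _ _ _ (fun n _ => memLp_Lfun n t h0)
  have hlim : ∀ᵐ ω ∂P, Tendsto (fun N => X (fun x => ∑ n ∈ Finset.range N, a ^ n * Lfun n t (hh j) x) ω) atTop
      (𝓝 (∑' n, a ^ n * xc X ω j k n)) := by
    filter_upwards [hsum, h.ae_e1] with ω h1 h2
    simp_rw [h1]
    apply HasSum.tendsto_sum_nat
    apply Summable.hasSum
    have := GoodX.summable_coef h2 j k (real_mem_UB hθ)
    rw [← Complex.summable_ofReal]
    refine this.congr fun n => ?_
    push_cast [haa]; rfl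
  have hX := h.limit hf hk (kfun_L2_lim ha t h0) hlim
  have hX2 := h.smul (hh j ^ a) hk
  filter_upwards [hX, hX2] with ω h1 h2
  have e : (fun x => fbmKernel θ t x - fbmKernel θ ((k:ℝ)/2^j) x) = fun x => hh j ^ a * kfun a ((t - x)/hh j) := by
    ext x; rw [hs, inc_eq h0]
  rw [e, h2, h1, Wx]
  push_cast
  rw [Complex.ofReal_cpow h0.le]
  simp only [haa]
  push_cast
  rfl

theorem ae_good (h : IsoProc P X) : ∀ᵐ ω ∂P, GoodX (xc X ω) := by
  have h2 : ∀ᵐ ω ∂P, ∀ j k (q : ℚ), (q : ℝ) ∈ Ioo (0:ℝ) 1 →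
      Wx (xc X ω) j k ((q:ℝ):ℂ) = Wx (xc X ω) (j+1) (2*k) ((q:ℝ):ℂ) + Wx (xc X ω) (j+1) (2*k+1) ((q:ℝ):ℂ) := by
    rw [ae_all_iff]; intro j
    rw [ae_all_iff]; intro k
    rw [ae_all_iff]; intro q
    by_cases hq : (q : ℝ) ∈ Ioo (0:ℝ) 1
    · have m1 : MemLp (fun x => fbmKernel q (((2*k+1:ℤ):ℝ)/2^(j+1)) x - fbmKernel q (((2*k:ℤ):ℝ)/2^(j+1)) x) 2 volume := (memLp_fbm hq (((2*k+1:ℤ):ℝ)/2^(j+1))).sub (memLp_fbm hq (((2*k:ℤ):ℝ)/2^(j+1)))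
      have m2 : MemLp (fun x => fbmKernel q ((((2*k+1:ℤ):ℝ)+1)/2^(j+1)) x - fbmKernel q (((2*k+1:ℤ):ℝ)/2^(j+1)) x) 2 volume := (memLp_fbm hq ((((2*k+1:ℤ):ℝ)+1)/2^(j+1))).sub (memLp_fbm hq (((2*k+1:ℤ):ℝ)/2^(j+1)))
      filter_upwards [h.W_eq hq j k, h.W_eq hq (j+1) (2*k), h.W_eq hq (j+1) (2*k+1),
        h.lin _ _ 1 1 m1 m2] with ω h1 h2 h3 h4 _
      rw [h1, h2, h3, ← Complex.ofReal_add]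
      congr 1
      simp only [one_mul] at h4
      have e1 : (((2*k:ℤ):ℝ)+1)/2^(j+1) = ((2*k+1:ℤ):ℝ)/2^(j+1) := by push_cast; ring
      rw [e1]
      have e2 : (((2*k:ℤ):ℝ))/2^(j+1) = k/2^j := by push_cast; rw [pow_succ]; field_simp
      have e3 : (((2*k+1:ℤ):ℝ)+1)/2^(j+1) = (k+1)/2^j := by push_cast; rw [pow_succ]; field_simp; ring
      rw [← e2, ← e3]
      refine Eq.trans ?_ h4
      congr 1
      ext x; ring
    · exact Eventually.of_forall fun ω hq' => absurd hq' hq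
  filter_upwards [h.ae_e1, h2] with ω h1 h2 using ⟨h1, h2⟩

end IsoProc


theorem hasDerivAt_iter {f : ℂ → ℂ} (hf : DifferentiableOn ℂ f UB) (n : ℕ) {θ : ℝ} (hθ : θ ∈ Ioo (0:ℝ) 1) :
    HasDerivAt (fun θ : ℝ => (iteratedDeriv n f θ).re) (iteratedDeriv (n+1) f θ).re θ := by
  have h1 : AnalyticAt ℂ f θ := (hf.analyticOnNhd Metric.isOpen_ball) _ (real_mem_UB hθ)
  have h2 := h1.iterated_deriv n
  rw [← iteratedDeriv_eq_iterate] at h2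
  have := h2.differentiableAt.hasDerivAt
  rw [← iteratedDeriv_succ] at this
  exact this.real_of_complex

theorem iteratedDerivWithin_re {f : ℂ → ℂ} (hf : DifferentiableOn ℂ f UB) (n : ℕ) :
    ∀ θ ∈ Ioo (0:ℝ) 1, iteratedDerivWithin n (fun θ : ℝ => (f θ).re) (Ioo 0 1) θ = (iteratedDeriv n f θ).re := by
  induction n with
  | zero => intro θ hθ; simp
  | succ n ih =>
    intro θ hθ
    rw [iteratedDerivWithin_succ, derivWithin_congr ih (ih θ hθ), derivWithin_of_isOpen isOpen_Ioo hθ]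
    exact (hasDerivAt_iter hf n hθ).deriv

theorem contDiffOn_re {f : ℂ → ℂ} (hf : DifferentiableOn ℂ f UB) :
    ContDiffOn ℝ (⊤ : ℕ∞) (fun θ : ℝ => (f θ).re) (Ioo 0 1) := by
  intro θ hθ
  have h1 : AnalyticAt ℂ f θ := (hf.analyticOnNhd Metric.isOpen_ball) _ (real_mem_UB hθ)
  exact (ContDiffAt.real_of_complex h1.contDiffAt).contDiffWithinAt

namespace GoodW
variable {W : ℕ → ℤ → ℂ → ℂ}

theorem iv_aux (h : GoodW W) (n : ℕ) {ε M a b : ℝ} (hε : 0 < ε) (hM : 0 < M) (ha : 0 < a) (hab : a < b) (hb : b < 1) :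
    ∃ C : ℝ, 0 < C ∧ ∀ t₁ θ₁ t₂ θ₂ : ℝ, t₁ ∈ Icc (-M) M → θ₁ ∈ Icc a b → t₂ ∈ Icc (-M) M → θ₂ ∈ Icc a b →
      |(iteratedDeriv n (FF W t₁) θ₁).re - (iteratedDeriv n (FF W t₂) θ₂).re|
        ≤ C * (|t₁ - t₂| ^ (max θ₁ θ₂ - ε) + |θ₁ - θ₂|) := by
  set d := min a (1 - b) with hd
  have hd0 : 0 < d := lt_min ha (by linarith)
  set η := min (ε/2) (d/4) with hη
  have hη0 : 0 < η := lt_min (by linarith) (by linarith)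
  have hη1 : η ≤ ε/2 := min_le_left _ _
  have hη2 : η ≤ d/4 := min_le_right _ _
  have hda : d ≤ a := min_le_left _ _
  have hdb : d ≤ 1 - b := min_le_right _ _
  obtain ⟨C, hC, hol⟩ := h.FF_holder (r := 1/2 - d + η) (ε := η) (M := M) (by linarith) hη0 (by linarith) hM
  have hball : ∀ θ ∈ Icc a b, ∀ z : ℂ, ‖z - θ‖ ≤ η → ‖z - 1/2‖ ≤ 1/2 - d + η := by
    intro θ hθ z hz
    have e : z - 1/2 = (z - θ) + ((θ - 1/2 : ℝ) : ℂ) := by push_cast; ring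
    rw [e]
    refine (norm_add_le _ _).trans ?_
    rw [Complex.norm_real, Real.norm_eq_abs]
    have : |θ - 1/2| ≤ 1/2 - d := by rw [abs_le]; constructor <;> linarith [hθ.1, hθ.2]
    linarith
  have hdc : ∀ t : ℝ, ∀ θ ∈ Icc a b, DiffContOnCl ℂ (FF W t) (Metric.ball (θ:ℂ) η) := by
    intro t θ hθ
    apply DifferentiableOn.diffContOnCl
    refine (h.FF_diff t).mono ?_
    refine Metric.closure_ball_subset_closedBall.trans fun z hz => ?_
    rw [Metric.mem_closedBall, dist_eq_norm] at hz
    rw [Metric.mem_ball, dist_eq_norm]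
    have := hball θ hθ z hz
    linarith
  have hIoo : ∀ θ ∈ Icc a b, θ ∈ Ioo (0:ℝ) 1 := fun θ hθ => ⟨by linarith [hθ.1], by linarith [hθ.2]⟩
  have hcd : ∀ t : ℝ, ∀ θ ∈ Icc a b, ContDiffAt ℂ n (FF W t) θ := fun t θ hθ =>
    (((h.FF_diff t).analyticOnNhd Metric.isOpen_ball) _ (real_mem_UB (hIoo θ hθ))).contDiffAt
  have hMabs : ∀ t ∈ Icc (-M) M, |t| ≤ M := fun t ht => abs_le.2 ht
  have hre : ∀ (z : ℂ) (θ : ℝ), ‖z - θ‖ ≤ η → |z.re - θ| ≤ η := by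
    intro z θ hz
    have := (Complex.abs_re_le_norm (z - θ)).trans hz
    simpa using this
  -- increments in t
  set K := (1 + 2 * M) ^ ε with hK
  have hK0 : 0 < K := by positivity
  set C1 := n.factorial * (C * K) / η ^ n with hC1
  have hC10 : 0 < C1 := by positivity
  have inc_t : ∀ t ∈ Icc (-M) M, ∀ s ∈ Icc (-M) M, ∀ θ ∈ Icc a b,
      |(iteratedDeriv n (FF W t) θ).re - (iteratedDeriv n (FF W s) θ).re| ≤ C1 * |t - s| ^ (θ - ε) := by
    intro t ht s hs θ hθ
    rcases eq_or_ne t s with rfl | hne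
    · rw [sub_self, abs_zero]; positivity
    have hu : 0 < |t - s| := abs_pos.2 (sub_ne_zero.2 hne)
    have hu2 : |t - s| ≤ 1 + 2 * M := by
      have := abs_sub t s; linarith [hMabs t ht, hMabs s hs]
    have key := Complex.norm_iteratedDeriv_le_of_forall_mem_sphere_norm_le n hη0 ((hdc t θ hθ).sub (hdc s θ hθ))
      (C := C * K * |t - s| ^ (θ - ε)) ?_
    · rw [iteratedDeriv_sub (hcd t θ hθ) (hcd s θ hθ)] at key
      rw [← Complex.sub_re]
      refine (Complex.abs_re_le_norm _).trans (key.trans (le_of_eq ?_))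
      rw [hC1]; ring
    · intro z hz
      rw [mem_sphere_iff_norm] at hz
      refine (hol t s z (hMabs t ht) (hMabs s hs) (hball θ hθ z hz.le)).trans ?_
      rw [mul_assoc]
      gcongr
      have h1 := abs_le.1 (hre z θ hz.le)
      have e : z.re - η = (z.re - η - (θ - ε)) + (θ - ε) := by ring
      rw [e, Real.rpow_add hu]
      gcongr
      calc |t - s| ^ (z.re - η - (θ - ε)) ≤ (1 + 2*M) ^ (z.re - η - (θ - ε)) :=
            Real.rpow_le_rpow hu.le hu2 (by linarith [h1.1])
        _ ≤ (1 + 2*M) ^ ε := Real.rpow_le_rpow_of_exponent_le (by linarith) (by linarith [h1.2])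
  -- increments in θ
  set C2 := (n+1).factorial * (C * (1 + M)) / η ^ (n+1) with hC2
  have hC20 : 0 < C2 := by positivity
  have inc_θ : ∀ t ∈ Icc (-M) M, ∀ θ₁ ∈ Icc a b, ∀ θ₂ ∈ Icc a b,
      |(iteratedDeriv n (FF W t) θ₁).re - (iteratedDeriv n (FF W t) θ₂).re| ≤ C2 * |θ₁ - θ₂| := by
    intro t ht θ₁ h1 θ₂ h2
    refine Convex.norm_image_sub_le_of_norm_hasDerivWithin_le (s := Icc a b) (f := fun θ : ℝ => (iteratedDeriv n (FF W t) θ).re)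
      (f' := fun θ : ℝ => (iteratedDeriv (n+1) (FF W t) θ).re)
      (fun θ hθ => (hasDerivAt_iter (h.FF_diff t) n (hIoo θ hθ)).hasDerivWithinAt) ?_ (convex_Icc a b) h2 h1
    intro θ hθ
    refine (Complex.abs_re_le_norm _).trans ?_
    refine Complex.norm_iteratedDeriv_le_of_forall_mem_sphere_norm_le (n+1) hη0 (hdc t θ hθ) ?_
    intro z hz
    rw [mem_sphere_iff_norm] at hz
    have hz' := hball θ hθ z hz.le
    have := hol t 0 z (hMabs t ht) (by simpa using hM.le) hz'
    rw [h.FF_zero (by rw [Metric.mem_ball, dist_eq_norm]; linarith), sub_zero, sub_zero] at this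
    refine this.trans ?_
    gcongr
    have hr := re_lower hz'
    calc |t| ^ (z.re - η) ≤ (1 + M) ^ (z.re - η) :=
          Real.rpow_le_rpow (abs_nonneg _) (by linarith [hMabs t ht]) (by linarith)
      _ ≤ (1 + M) ^ (1:ℝ) := Real.rpow_le_rpow_of_exponent_le (by linarith) (by linarith)
      _ = 1 + M := Real.rpow_one _
  refine ⟨max C1 C2, lt_max_of_lt_left hC10, ?_⟩
  intro t₁ θ₁ t₂ θ₂ ht₁ hθ₁ ht₂ hθ₂
  wlog hle : θ₂ ≤ θ₁ generalizing t₁ θ₁ t₂ θ₂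
  · have := this t₂ θ₂ t₁ θ₁ ht₂ hθ₂ ht₁ hθ₁ (le_of_not_ge hle)
    rwa [abs_sub_comm, abs_sub_comm t₁, abs_sub_comm θ₁, max_comm θ₁]
  rw [max_eq_left hle]
  have a1 := inc_t t₁ ht₁ t₂ ht₂ θ₁ hθ₁
  have a2 := inc_θ t₂ ht₂ θ₁ hθ₁ θ₂ hθ₂
  have b1 : C1 * |t₁ - t₂| ^ (θ₁ - ε) ≤ max C1 C2 * |t₁ - t₂| ^ (θ₁ - ε) := by gcongr; exact le_max_left _ _
  have b2 : C2 * |θ₁ - θ₂| ≤ max C1 C2 * |θ₁ - θ₂| := by gcongr; exact le_max_right _ _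
  have := abs_sub_le (iteratedDeriv n (FF W t₁) θ₁).re (iteratedDeriv n (FF W t₂) θ₁).re (iteratedDeriv n (FF W t₂) θ₂).re
  linarith

theorem iv0 (h : GoodW W) {ε M a b : ℝ} (hε : 0 < ε) (hM : 0 < M) (ha : 0 < a) (hab : a < b) (hb : b < 1) :
    ∃ C : ℝ, 0 < C ∧ ∀ t₁ θ₁ t₂ θ₂ : ℝ, t₁ ∈ Icc (-M) M → θ₁ ∈ Icc a b → t₂ ∈ Icc (-M) M → θ₂ ∈ Icc a b →
      |(FF W t₁ θ₁).re - (FF W t₂ θ₂).re|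
        ≤ C * (|t₁ - t₂| ^ (max θ₁ θ₂ - ε) + |θ₁ - θ₂|) := by
  simpa using h.iv_aux 0 hε hM ha hab hb

theorem cont (h : GoodW W) : ContinuousOn (fun p : ℝ × ℝ => (FF W p.1 p.2).re) (Set.univ ×ˢ Set.Ioo (0:ℝ) 1) := by
  rintro ⟨t, θ⟩ ⟨-, hθ⟩
  simp only at hθ
  apply ContinuousAt.continuousWithinAt
  obtain ⟨C, hC, hb⟩ := h.iv0 (ε := θ/4) (M := |t|+1) (a := θ/2) (b := (1+θ)/2) (by linarith [hθ.1]) (by positivity) (by linarith [hθ.1])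
    (by linarith [hθ.1]) (by linarith [hθ.2])
  rw [ContinuousAt, tendsto_iff_dist_tendsto_zero]
  have hlim : Tendsto (fun p : ℝ × ℝ => C * (|p.1 - t| ^ (θ/4) + |p.2 - θ|)) (𝓝 (t,θ)) (𝓝 0) := by
    have hcont : ContinuousAt (fun p : ℝ × ℝ => C * (|p.1 - t| ^ (θ/4) + |p.2 - θ|)) (t,θ) := by
      apply ContinuousAt.mul continuousAt_const
      apply ContinuousAt.add
      · apply ContinuousAt.rpow_const (by fun_prop)
        right; linarith [hθ.1]
      · fun_prop
    have := hcont.tendsto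
    simpa [Real.zero_rpow (show θ/4 ≠ 0 by linarith [hθ.1])] using this
  refine squeeze_zero' (Eventually.of_forall fun _ => dist_nonneg) ?_ hlim
  have n1 : ∀ᶠ p : ℝ × ℝ in 𝓝 (t,θ), |p.1 - t| < 1 := by
    have : ContinuousAt (fun p : ℝ × ℝ => |p.1 - t|) (t,θ) := by fun_prop
    exact this.eventually_lt continuousAt_const (by simp)
  have n2 : ∀ᶠ p : ℝ × ℝ in 𝓝 (t,θ), p.2 ∈ Ioo (θ/2) ((1+θ)/2) := by
    have : ContinuousAt (fun p : ℝ × ℝ => p.2) (t,θ) := by fun_prop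
    exact this.eventually (isOpen_Ioo.mem_nhds ⟨by simp only; linarith [hθ.1], by simp only; linarith [hθ.2]⟩)
  filter_upwards [n1, n2] with p h1 h2
  have e1 := abs_lt.1 h1
  have := hb p.1 p.2 t θ ⟨by linarith [neg_abs_le t], by linarith [le_abs_self t]⟩ ⟨h2.1.le, h2.2.le⟩
    ⟨by linarith [neg_abs_le t], by linarith [le_abs_self t]⟩ ⟨by linarith [hθ.1], by linarith [hθ.2]⟩
  rw [Real.dist_eq]
  refine this.trans ?_
  have h5 : |p.1 - t| ^ (max p.2 θ - θ / 4) ≤ |p.1 - t| ^ (θ / 4) := by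
    apply Real.rpow_le_rpow_of_exponent_ge' (abs_nonneg _) h1.le (by linarith [hθ.1])
    have := le_max_right p.2 θ
    linarith [hθ.1]
  gcongr

theorem holder_ptwise (h : GoodW W) {ε : ℝ} (hε : 0 < ε) (s : ℝ) {θ : ℝ} (hθ : θ ∈ Ioo (0:ℝ) 1) :
    Tendsto (fun x : ℝ => |(FF W (s + x) θ).re - (FF W s θ).re| / |x| ^ (θ - ε)) (𝓝[≠] 0) (𝓝 0) := by
  obtain ⟨C, hC, hb⟩ := h.iv0 (ε := ε/2) (M := |s|+1) (a := θ/2) (b := (1+θ)/2) (by linarith [hθ.1]) (by positivity) (by linarith [hθ.1])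
    (by linarith [hθ.1]) (by linarith [hθ.2])
  have hlim : Tendsto (fun x : ℝ => C * |x| ^ (ε/2)) (𝓝[≠] 0) (𝓝 0) := by
    have hcont : ContinuousAt (fun x : ℝ => C * |x| ^ (ε/2)) 0 := by
      apply ContinuousAt.mul continuousAt_const
      apply ContinuousAt.rpow_const (by fun_prop)
      right; linarith
    have := hcont.tendsto
    simp only [abs_zero, Real.zero_rpow (show ε/2 ≠ 0 by linarith), mul_zero] at this
    exact this.mono_left nhdsWithin_le_nhds
  refine squeeze_zero' (Eventually.of_forall fun _ => by positivity) ?_ hlim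
  have n1 : ∀ᶠ x : ℝ in 𝓝[≠] 0, |x| < 1 := by
    have : ContinuousAt (fun x : ℝ => |x|) 0 := by fun_prop
    exact nhdsWithin_le_nhds (this.eventually_lt continuousAt_const (by simp))
  filter_upwards [n1, self_mem_nhdsWithin] with x h1 h2
  have hx : 0 < |x| := abs_pos.2 h2
  have e1 := abs_lt.1 h1
  have := hb (s+x) θ s θ ⟨by linarith [neg_abs_le s], by linarith [le_abs_self s]⟩ ⟨by linarith [hθ.1], by linarith [hθ.2]⟩
    ⟨by linarith [neg_abs_le s], by linarith [le_abs_self s]⟩ ⟨by linarith [hθ.1], by linarith [hθ.2]⟩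
  rw [div_le_iff₀ (by positivity)]
  refine this.trans (le_of_eq ?_)
  rw [mul_assoc, ← Real.rpow_add hx, add_sub_cancel_left, sub_self, abs_zero, add_zero, max_self]
  congr 2; ring

end GoodW

namespace IsoProc
variable {Ω : Type} {mΩ : MeasurableSpace Ω} {P : Measure Ω} {X : (ℝ → ℝ) → Ω → ℝ}

theorem SS_eq (h : IsoProc P X) {θ : ℝ} (hθ : θ ∈ Ioo (0:ℝ) 1) :
    ∀ᵐ ω ∂P, ∀ (j : ℕ) (k : ℤ), SS (Wx (xc X ω)) j k θ = (X (fbmKernel θ ((k:ℝ)/2^j)) ω : ℂ) := by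
  have h1 : ∀ᵐ ω ∂P, ∀ (j : ℕ) (k : ℤ), Wx (xc X ω) j k (θ : ℂ) =
      (X (fbmKernel θ (((k+1:ℤ):ℝ)/2^j)) ω : ℂ) - (X (fbmKernel θ ((k:ℝ)/2^j)) ω : ℂ) := by
    rw [ae_all_iff]; intro j
    rw [ae_all_iff]; intro k
    filter_upwards [h.W_eq hθ j k, h.sub (memLp_fbm hθ (((k:ℝ)+1)/2^j)) (memLp_fbm hθ ((k:ℝ)/2^j))] with ω h1 h2
    rw [h1, h2]; push_cast; rfl
  have h0 := h.zero
  filter_upwards [h1, h0] with ω h1 h0 j k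
  induction k using Int.induction_on with
  | zero => simp [SS_zero, fbmKernel_zero, h0]
  | succ i ih => rw [SS_succ, ih, h1]; ring
  | pred i ih =>
    have e := SS_succ (Wx (xc X ω)) j (-(i:ℤ) - 1) θ
    rw [h1, sub_add_cancel, ih] at e
    linear_combination -e

theorem FF_eq (h : IsoProc P X) {θ : ℝ} (hθ : θ ∈ Ioo (0:ℝ) 1) (t : ℝ) :
    ∀ᵐ ω ∂P, (FF (Wx (xc X ω)) t θ).re = X (fbmKernel θ t) ω := by
  have hle : ∀ j : ℕ, ((⌊(2:ℝ)^j * t⌋:ℝ)/2^j) ≤ t := fun j => by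
    rw [div_le_iff₀ (by positivity), mul_comm]; exact Int.floor_le _
  have hge : ∀ j : ℕ, t - ((⌊(2:ℝ)^j * t⌋:ℝ)/2^j) ≤ (1/2)^j := fun j => by
    have := Int.lt_floor_add_one ((2:ℝ)^j * t)
    rw [one_div, inv_pow, sub_le_iff_le_add, ← one_div, ← add_div, le_div_iff₀ (by positivity)]
    linarith
  have hz := real_mem_UB hθ
  have key := h.limit (f := fun j : ℕ => fbmKernel θ ((⌊(2:ℝ)^j * t⌋:ℝ)/2^j)) (g := fbmKernel θ t)
    (Y := fun ω => (FF (Wx (xc X ω)) t θ).re) (fun j => memLp_fbm hθ _) (memLp_fbm hθ _) ?_ ?_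
  · filter_upwards [key] with ω hω using hω.symm
  · set κ := ∫ x, kfun (θ - 1/2) x ^ 2 with hκ
    have hκ0 : 0 ≤ κ := integral_nonneg fun x => by positivity
    have hb : ∀ j : ℕ, ∫ x, (fbmKernel θ ((⌊(2:ℝ)^j * t⌋:ℝ)/2^j) x - fbmKernel θ t x) ^ 2 ≤ ((1/2:ℝ)^(2*θ))^j * κ := by
      intro j
      rcases (hle j).eq_or_lt with e | e
      · rw [e]; simp; positivity
      · have := integral_inc_sq θ t (h := t - ((⌊(2:ℝ)^j * t⌋:ℝ)/2^j)) (by linarith)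
        rw [sub_sub_cancel] at this
        simp_rw [sub_sq_comm (fbmKernel θ ((⌊(2:ℝ)^j * t⌋:ℝ)/2^j) _)]
        rw [this, ← GoodW.hh_rpow]
        refine mul_le_mul_of_nonneg_right ?_ hκ0
        exact Real.rpow_le_rpow (by linarith) (hge j) (by linarith [hθ.1])
    refine squeeze_zero (fun j => integral_nonneg fun x => by positivity) hb ?_
    rw [← zero_mul κ]
    refine Tendsto.mul_const _ (tendsto_pow_atTop_nhds_zero_of_lt_one (by positivity) ?_)
    exact Real.rpow_lt_one (by norm_num) (by norm_num) (by linarith [hθ.1])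
  · filter_upwards [h.SS_eq hθ, h.ae_good] with ω h1 h2
    have hz' : ‖(θ:ℂ) - 1/2‖ < 1/2 := by rwa [Metric.mem_ball, dist_eq_norm] at hz
    obtain ⟨C, hC, h3, -⟩ := h2.goodW.FF_approx (r := ‖(θ:ℂ) - 1/2‖) (ε := (1/2 - ‖(θ:ℂ) - 1/2‖)/2) (M := |t|+1) hz' (by linarith) (by linarith) (by positivity)
    have := (h3 0 t θ (by linarith) le_rfl).1
    have := (Complex.continuous_re.tendsto _).comp this
    refine this.congr fun j => ?_
    simp only [Function.comp, FFj, h1, Complex.ofReal_re]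

end IsoProc


theorem gauss_small_ball {v : NNReal} (hv : v ≠ 0) (y η : ℝ) :
    gaussianReal 0 v {x | |x + y| ≤ η} ≤ ENNReal.ofReal (2 * η / √(2 * Real.pi * v)) := by
  have hs : {x : ℝ | |x + y| ≤ η} = Icc (-y - η) (-y + η) := by
    ext x; simp only [Set.mem_ofPred_eq, mem_Icc, abs_le]
    constructor <;> rintro ⟨h1, h2⟩ <;> constructor <;> linarith
  rw [hs, gaussianReal_apply 0 hv]
  have hle : ∀ x, gaussianPDF 0 v x ≤ ENNReal.ofReal ((√(2 * Real.pi * v))⁻¹) := by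
    intro x
    unfold gaussianPDF
    apply ENNReal.ofReal_le_ofReal
    rw [gaussianPDFReal_def]
    refine mul_le_of_le_one_right (by positivity) ?_
    rw [Real.exp_le_one_iff]
    apply div_nonpos_of_nonpos_of_nonneg
    · have := sq_nonneg (x - 0); linarith
    · positivity
  calc _ ≤ ∫⁻ x in Icc (-y - η) (-y + η), ENNReal.ofReal ((√(2 * Real.pi * v))⁻¹) := lintegral_mono hle
    _ = ENNReal.ofReal ((√(2 * Real.pi * v))⁻¹) * ENNReal.ofReal (2 * η) := by
        rw [setLIntegral_const, Real.volume_Icc]; congr 2; ring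
    _ = _ := by rw [← ENNReal.ofReal_mul (by positivity)]; congr 1; ring

theorem indep_small_ball {Ω : Type} {mΩ : MeasurableSpace Ω} {P : Measure Ω} [IsProbabilityMeasure P]
    {Y : Ω → ℝ} {V : Ω → ℕ → ℝ} (hY : Measurable Y) (hV : Measurable V) (hi : IndepFun Y V P)
    {η : ℝ} {p : ENNReal} (hp : ∀ y, P.map Y {x | |x + y| ≤ η} ≤ p) {A : Set (ℕ → ℝ)} (hA : MeasurableSet A) (m : ℕ) :
    P {ω | |Y ω + V ω m| ≤ η ∧ V ω ∈ A} ≤ p * P {ω | V ω ∈ A} := by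
  have hmap := (indepFun_iff_map_prod_eq_prod_map_map hY.aemeasurable hV.aemeasurable).1 hi
  set S : Set (ℝ × (ℕ → ℝ)) := {z | |z.1 + z.2 m| ≤ η} ∩ {z | z.2 ∈ A} with hS
  have hSm : MeasurableSet S := by
    refine MeasurableSet.inter (measurableSet_le (by fun_prop) (by fun_prop)) (measurable_snd hA)
  have : IsProbabilityMeasure (P.map Y) := Measure.isProbabilityMeasure_map hY.aemeasurable
  have : IsProbabilityMeasure (P.map V) := Measure.isProbabilityMeasure_map hV.aemeasurable
  have e1 : P {ω | |Y ω + V ω m| ≤ η ∧ V ω ∈ A} = (P.map (fun ω => (Y ω, V ω))) S := by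
    rw [Measure.map_apply (hY.prodMk hV) hSm]; rfl
  rw [e1, hmap, Measure.prod_apply_symm hSm]
  calc _ ≤ ∫⁻ v, A.indicator (fun _ => p) v ∂(P.map V) := by
        refine lintegral_mono fun v => ?_
        by_cases hv : v ∈ A
        · rw [indicator_of_mem hv]
          exact (measure_mono (fun x hx => hx.1)).trans (hp (v m))
        · rw [indicator_of_notMem hv]
          have : (fun x => (x, v)) ⁻¹' S = (∅ : Set ℝ) := by
            ext x; simp [hS, hv]
          rw [this]; simp
    _ = p * P.map V A := by rw [lintegral_indicator_const hA]
    _ = _ := by rw [Measure.map_apply hV hA]; rfl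

/-- normalised innovation kernel -/
def gam (a v : ℝ) : ℝ := (Ioo (0:ℝ) 1).indicator (fun v => v ^ a) v

theorem measurable_gam (a : ℝ) : Measurable (gam a) := Measurable.indicator (by fun_prop) measurableSet_Ioo

theorem gam_sq (a v : ℝ) : gam a v ^ 2 = (Ioo (0:ℝ) 1).indicator (fun v => v ^ (a*2)) v := by
  simp only [gam, indicator]
  split_ifs with hv
  · rw [Real.rpow_mul hv.1.le]; norm_num
  · simp

theorem memLp_gam {a : ℝ} (ha : -(1/2) < a) : MemLp (gam a) 2 volume := by
  rw [memLp_two_iff_integrable_sq (measurable_gam a).aestronglyMeasurable]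
  simp_rw [gam_sq]
  rw [integrable_indicator_iff measurableSet_Ioo, ← integrableOn_Ioc_iff_integrableOn_Ioo,
    ← intervalIntegrable_iff_integrableOn_Ioc_of_le (by norm_num)]
  exact intervalIntegral.intervalIntegrable_rpow' (by linarith)

theorem integral_gam_sq {a : ℝ} (ha : -(1/2) < a) : ∫ v, gam a v ^ 2 = (2*a+1)⁻¹ := by
  simp_rw [gam_sq]
  rw [integral_indicator measurableSet_Ioo, ← integral_Ioc_eq_integral_Ioo, ← intervalIntegral.integral_of_le (by norm_num),
    integral_rpow (Or.inl (by linarith)), Real.one_rpow, Real.zero_rpow (by linarith), sub_zero, one_div, mul_comm]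

def incf (θ : ℝ) (j : ℕ) (k : ℤ) (x : ℝ) : ℝ := fbmKernel θ (((k:ℝ)+1)/2^j) x - fbmKernel θ ((k:ℝ)/2^j) x

theorem memLp_incf {θ : ℝ} (hθ : θ ∈ Ioo (0:ℝ) 1) (j : ℕ) (k : ℤ) : MemLp (incf θ j k) 2 volume :=
  (memLp_fbm hθ _).sub (memLp_fbm hθ _)

def gin (θ : ℝ) (j : ℕ) (k : ℤ) (x : ℝ) : ℝ := hh j ^ (θ - 1/2) * gam (θ - 1/2) (((((k:ℝ)+1)/2^j) - x)/hh j)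

theorem memLp_gin {θ : ℝ} (hθ : θ ∈ Ioo (0:ℝ) 1) (j : ℕ) (k : ℤ) : MemLp (gin θ j k) 2 volume :=
  (memLp_comp_affine (measurable_gam _) (memLp_gam (by linarith [hθ.1])) _ (hh_pos j)).const_mul _

theorem integral_gin_sq {θ : ℝ} (hθ : θ ∈ Ioo (0:ℝ) 1) (j : ℕ) (k : ℤ) :
    ∫ x, gin θ j k x ^ 2 = hh j ^ (2*θ) * (2*θ)⁻¹ := by
  unfold gin
  have h0 := hh_pos j
  simp_rw [mul_pow]
  rw [integral_const_mul, integral_comp_affine (fun x => gam (θ - 1/2) x ^ 2) _ h0, integral_gam_sq (by linarith [hθ.1]), ← mul_assoc]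
  congr 1
  · rw [← Real.rpow_mul_natCast h0.le]
    nth_rewrite 2 [← Real.rpow_one (hh j)]
    rw [← Real.rpow_add h0]; congr 1; push_cast; ring
  · congr 1; ring

theorem step_eq (j : ℕ) (k : ℤ) : ((k:ℝ)+1)/2^j = k/2^j + hh j := by
  rw [hh, one_div, inv_pow]; field_simp

theorem incf_eq (θ : ℝ) (j : ℕ) (k : ℤ) (x : ℝ) :
    incf θ j k x = posRPow (((k:ℝ)+1)/2^j - x) (θ - 1/2) - posRPow ((k:ℝ)/2^j - x) (θ - 1/2) := by
  unfold incf fbmKernel; ring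

theorem gin_eq_zero {θ : ℝ} {j : ℕ} {k : ℤ} {x : ℝ} (hx : x ≤ k/2^j) : gin θ j k x = 0 := by
  unfold gin gam
  rw [indicator_of_notMem, mul_zero]
  intro h
  have := h.2
  rw [div_lt_one (hh_pos j), step_eq] at this
  linarith

theorem incf_eq_gin {θ : ℝ} {j : ℕ} {k : ℤ} {x : ℝ} (hx : k/2^j < x) : incf θ j k x = gin θ j k x := by
  have h0 := hh_pos j
  rw [incf_eq]
  have e2 : posRPow ((k:ℝ)/2^j - x) (θ - 1/2) = 0 := by unfold posRPow; rw [if_neg (by linarith)]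
  rw [e2, sub_zero]
  unfold gin gam
  set u := ((k:ℝ)+1)/2^j - x with hu
  have hu1 : u < hh j := by rw [hu, step_eq]; linarith
  by_cases h : 0 < u
  · rw [indicator_of_mem (show u / hh j ∈ Ioo (0:ℝ) 1 from ⟨by positivity, by rwa [div_lt_one h0]⟩)]
    rw [posRPow, if_pos h, ← Real.mul_rpow h0.le (by positivity)]
    congr 1; field_simp
  · rw [indicator_of_notMem, posRPow, if_neg h, mul_zero]
    intro h'
    exact h ((div_pos_iff_of_pos_right h0).1 h'.1)

theorem incf_eq_zero {θ : ℝ} {j : ℕ} {k : ℤ} {x : ℝ} (hx : ((k:ℝ)+1)/2^j ≤ x) : incf θ j k x = 0 := by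
  have h0 := hh_pos j
  have := step_eq j k
  rw [incf_eq, posRPow, posRPow, if_neg (by linarith), if_neg (by linarith), sub_zero]

namespace IsoProc
variable {Ω : Type} {mΩ : MeasurableSpace Ω} {P : Measure Ω} {X : (ℝ → ℝ) → Ω → ℝ}

theorem small_run [IsProbabilityMeasure P] (h : IsoProc P X) {θ : ℝ} (hθ : θ ∈ Ioo (0:ℝ) 1) (j : ℕ) (k : ℤ)
    {C ε : ℝ} (hC : 0 ≤ C) (m : ℕ) :
    P {ω | ∀ i < m, |X (incf θ j (k+i)) ω| ≤ C * hh j ^ (θ + ε)} ≤ ENNReal.ofReal (2 * C * hh j ^ ε) ^ m := by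
  set η := C * hh j ^ (θ + ε) with hη
  have h0 := hh_pos j
  induction m with
  | zero => simp
  | succ m ih =>
    set g := gin θ j (k+m) with hg
    set r : ℝ → ℝ := fun x => incf θ j (k+m) x - g x with hr
    have mg : MemLp g 2 volume := memLp_gin hθ _ _
    have mf := memLp_incf hθ j (k+m)
    have mr : MemLp r 2 volume := mf.sub mg
    set φ : ℕ → ℝ → ℝ := fun l => if l < m then incf θ j (k+l) else r with hφ
    have mφ : ∀ l, MemLp (φ l) 2 volume := by
      intro l; simp only [hφ]; split_ifs
      · exact memLp_incf hθ _ _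
      · exact mr
    have orth : ∀ l, ∫ x, g x * φ l x = 0 := by
      intro l
      rw [← integral_zero ℝ ℝ (μ := volume)]
      congr 1; ext x
      rcases le_or_gt x (((k+m:ℤ):ℝ)/2^j) with hx | hx
      · rw [hg, gin_eq_zero hx, zero_mul]
      · simp only [hφ]
        split_ifs with hl
        · rw [incf_eq_zero, mul_zero]
          refine le_trans ?_ hx.le
          gcongr
          have : (l:ℝ) + 1 ≤ m := by exact_mod_cast hl
          push_cast; linarith
        · simp only [hr]; rw [incf_eq_gin hx, ← hg, sub_self, mul_zero]
    have hi := h.indep φ mg mφ orth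
    have hv0 : 0 < ∫ x, g x ^ 2 := by
      rw [hg, integral_gin_sq hθ]; have := hθ.1; positivity
    have hp : ∀ y, P.map (X g) {x | |x + y| ≤ η} ≤ ENNReal.ofReal (2 * C * hh j ^ ε) := by
      intro y
      rw [h.law g mg]
      refine (gauss_small_ball (by simpa using hv0) y η).trans (ENNReal.ofReal_le_ofReal ?_)
      rw [Real.coe_toNNReal _ hv0.le, div_le_iff₀ (by positivity), hη, Real.rpow_add h0]
      have hsq : hh j ^ θ ≤ √(2 * Real.pi * ∫ x, g x ^ 2) := by
        apply Real.le_sqrt_of_sq_le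
        rw [hg, integral_gin_sq hθ, ← Real.rpow_mul_natCast h0.le, mul_comm θ]
        push_cast
        have hq : 1 ≤ 2 * Real.pi * (2*θ)⁻¹ := by
          rw [← div_eq_mul_inv, le_div_iff₀ (by linarith [hθ.1])]
          have := Real.pi_gt_three; linarith [hθ.2]
        have hx : 0 < hh j ^ (2*θ) := by positivity
        nlinarith
      have : 0 ≤ 2 * C * hh j ^ ε := by positivity
      nlinarith
    have hA : MeasurableSet {v : ℕ → ℝ | ∀ i < m, |v i| ≤ η} := by
      have : {v : ℕ → ℝ | ∀ i < m, |v i| ≤ η} = ⋂ i, ⋂ (_ : i < m), {v | |v i| ≤ η} := by ext; simp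
      rw [this]
      exact MeasurableSet.iInter fun i => MeasurableSet.iInter fun _ => measurableSet_le (by fun_prop) (by fun_prop)
    have key := indep_small_ball (h.meas g) (measurable_pi_lambda _ fun l => h.meas (φ l)) hi hp hA m
    have hVA : {ω | (fun i => X (φ i) ω) ∈ {v : ℕ → ℝ | ∀ i < m, |v i| ≤ η}} = {ω | ∀ i < m, |X (incf θ j (k+i)) ω| ≤ η} := by
      ext ω
      simp only [Set.mem_ofPred_eq]
      refine forall₂_congr fun i hi => ?_
      simp only [hφ, if_pos hi]
    rw [hVA] at key
    rw [pow_succ, mul_comm]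
    refine le_trans ?_ (key.trans (mul_le_mul_right ih _))
    apply measure_mono_ae
    filter_upwards [h.sub mf mg] with ω hω hE
    refine ⟨?_, ?_⟩
    · have e : φ m = r := by simp [hφ]
      rw [e, hω, add_sub_cancel]
      exact hE m (by omega)
    · have : ω ∈ {ω | ∀ i < m, |X (incf θ j (k+i)) ω| ≤ η} := fun i hi => hE i (by omega)
      rw [← hVA] at this
      exact this

/-- exceptional events -/
def badE (X : (ℝ → ℝ) → Ω → ℝ) (C p M j : ℕ) : Set Ω :=
  ⋃ k ∈ (Finset.Icc (-((M:ℤ) * 2^j)) ((M:ℤ) * 2^j) : Finset ℤ), ⋃ q ∈ (Finset.Ico 1 (4^j) : Finset ℕ),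
    {ω | ∀ i : ℕ, i < 4*(p+1) → |X (incf ((q:ℝ)/4^j) j (k+(i:ℤ))) ω| ≤ C * hh j ^ ((q:ℝ)/4^j + 1/((p:ℝ)+1))}

theorem badE_le [IsProbabilityMeasure P] (h : IsoProc P X) (C p M j : ℕ) :
    P (badE X C p M j) ≤ ENNReal.ofReal ((2*M+1) * (2*C)^(4*(p+1)) * (1/2)^j) := by
  have h0 := hh_pos j
  set v := ENNReal.ofReal ((2*C)^(4*(p+1)) * (hh j)^4) with hv
  have h1 : ∀ k : ℤ, ∀ q ∈ (Finset.Ico 1 (4^j) : Finset ℕ), P {ω | ∀ i : ℕ, i < 4*(p+1) → |X (incf ((q:ℝ)/4^j) j (k+(i:ℤ))) ω| ≤ C * hh j ^ ((q:ℝ)/4^j + 1/((p:ℝ)+1))} ≤ v := by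
    intro k q hq
    rw [Finset.mem_Ico] at hq
    have hθ : (q:ℝ)/4^j ∈ Ioo (0:ℝ) 1 := by
      have : 0 < (q:ℝ) := Nat.cast_pos.2 (by omega)
      refine ⟨by positivity, ?_⟩
      rw [div_lt_one (by positivity)]; exact_mod_cast hq.2
    refine (h.small_run hθ j k (by positivity) (4*(p+1))).trans (le_of_eq ?_)
    rw [← ENNReal.ofReal_pow (by positivity), hv, mul_pow]
    congr 2
    rw [← Real.rpow_mul_natCast h0.le]
    have : 1/((p:ℝ)+1) * ((4*(p+1) : ℕ):ℝ) = (4:ℕ) := by push_cast; field_simp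
    rw [this, Real.rpow_natCast]
  calc P (badE X C p M j) ≤ ∑ k ∈ (Finset.Icc (-((M:ℤ) * 2^j)) ((M:ℤ) * 2^j) : Finset ℤ), ∑ q ∈ (Finset.Ico 1 (4^j) : Finset ℕ), v := by
        refine (measure_biUnion_finset_le _ _).trans (Finset.sum_le_sum fun k _ => ?_)
        exact (measure_biUnion_finset_le _ _).trans (Finset.sum_le_sum fun q hq => h1 k q hq)
    _ = ENNReal.ofReal ((((M * 2^j + 1 - (-(M * 2^j)) : ℤ).toNat : ℝ) * ((4^j - 1 : ℕ) : ℝ)) * ((2*C)^(4*(p+1)) * (hh j)^4)) := by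
        rw [Finset.sum_const, Finset.sum_const, Int.card_Icc, Nat.card_Ico, nsmul_eq_mul, nsmul_eq_mul, ENNReal.ofReal_mul (by positivity),
          ENNReal.ofReal_mul (by positivity), ENNReal.ofReal_natCast, ENNReal.ofReal_natCast, mul_assoc]
    _ ≤ _ := by
        apply ENNReal.ofReal_le_ofReal
        have e1 : ((M * 2^j + 1 - (-(M * 2^j)) : ℤ).toNat : ℝ) ≤ (2*M+1) * 2^j := by
          have : ((M * 2^j + 1 - (-(M * 2^j)) : ℤ).toNat : ℤ) = M * 2^j + 1 - (-(M * 2^j)) := Int.toNat_of_nonneg (by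
            have : (0:ℤ) ≤ M * 2^j := by positivity
            linarith)
          have e2 : ((M * 2^j + 1 - (-(M * 2^j)) : ℤ).toNat : ℝ) = M * 2^j + 1 - (-(M * 2^j)) := by exact_mod_cast this
          rw [e2]
          have : (1:ℝ) ≤ 2^j := one_le_pow₀ (by norm_num)
          linarith
        have e2 : ((4^j - 1 : ℕ) : ℝ) ≤ 4^j := by
          have : 4^j - 1 ≤ 4^j := Nat.sub_le _ _
          exact_mod_cast this
        have e3 : (2:ℝ)^j * 4^j * (hh j)^4 = (1/2)^j := by
          unfold hh
          rw [← mul_pow, ← pow_mul, mul_comm j 4, pow_mul, ← mul_pow]; norm_num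
        calc _ ≤ (((2*M+1) * 2^j) * 4^j) * ((2*(C:ℝ))^(4*(p+1)) * (hh j)^4) := by gcongr
          _ = (2*M+1) * (2*(C:ℝ))^(4*(p+1)) * (2^j * 4^j * (hh j)^4) := by ring
          _ = _ := by rw [e3]

theorem ae_not_bad [IsProbabilityMeasure P] (h : IsoProc P X) :
    ∀ᵐ ω ∂P, ∀ C p M : ℕ, ∀ᶠ j in atTop, ω ∉ badE X C p M j := by
  rw [ae_all_iff]; intro C
  rw [ae_all_iff]; intro p
  rw [ae_all_iff]; intro M
  apply ae_eventually_notMem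
  refine ne_top_of_le_ne_top ?_ (ENNReal.tsum_le_tsum fun j => h.badE_le C p M j)
  apply Summable.tsum_ofReal_ne_top
  exact (summable_geometric_of_lt_one (by norm_num) (by norm_num)).mul_left _

end IsoProc

set_option maxHeartbeats 2000000 in
theorem GoodW.lower {W : ℕ → ℤ → ℂ → ℂ} (hW : GoodW W)
    (hbad : ∀ C p M : ℕ, ∀ᶠ j : ℕ in atTop, ¬ ∃ k : ℤ, -((M:ℤ) * 2^j) ≤ k ∧ k ≤ (M:ℤ) * 2^j ∧
      ∃ q : ℕ, 1 ≤ q ∧ q < 4^j ∧ ∀ i : ℕ, i < 4*(p+1) →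
      |(W j (k+(i:ℤ)) (((q:ℝ)/4^j : ℝ):ℂ)).re| ≤ C * hh j ^ ((q:ℝ)/4^j + 1/((p:ℝ)+1)))
    {ε : ℝ} (hε : 0 < ε) (s : ℝ) {θ : ℝ} (hθ : θ ∈ Ioo (0:ℝ) 1) (C : ℝ) :
    ∃ᶠ h : ℝ in 𝓝[≠] 0, C < |(FF W (s + h) θ).re - (FF W s θ).re| / |h| ^ (θ + ε) := by
  obtain ⟨hθ0, hθ1⟩ := hθ
  by_contra hcon
  rw [not_frequently, eventually_nhdsWithin_iff, Metric.eventually_nhds_iff] at hcon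
  obtain ⟨ρ, hρ, hcon⟩ := hcon
  have hF : ∀ x : ℝ, |x| < ρ → |(FF W (s + x) θ).re - (FF W s θ).re| ≤ |C| * |x| ^ (θ + ε) := by
    intro x hx
    by_cases h0 : x = 0
    · subst h0; simp; positivity
    have := hcon (y := x) (by simpa using hx) h0
    rw [not_lt, div_le_iff₀ (by positivity)] at this
    exact this.trans (by gcongr; exact le_abs_self _)
  obtain ⟨p, hp⟩ := exists_nat_one_div_lt hε
  set ε' := 1/((p:ℝ)+1) with hε'
  have hε'0 : 0 < ε' := by positivity
  have hε'1 : ε' ≤ 1 := by rw [hε', div_le_one (by positivity)]; linarith [(Nat.cast_nonneg p : (0:ℝ) ≤ p)]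
  set m := 4*(p+1) with hm
  obtain ⟨C1, hC1, hiv⟩ := hW.iv0 (ε := θ/4) (M := |s|+2) (a := θ/2) (b := (1+θ)/2) (by linarith) (by positivity)
    (by linarith) (by linarith) (by linarith)
  set D := 2 * |C| * ((m:ℝ)+1)^2 + 2 * C1 with hD
  have hδ : Tendsto hh atTop (𝓝 0) := tendsto_pow_atTop_nhds_zero_of_lt_one (by norm_num) (by norm_num)
  have hδ1 : ∀ᶠ j in atTop, ((m:ℝ)+1) * hh j < min ρ 1 := by
    have : Tendsto (fun j => ((m:ℝ)+1) * hh j) atTop (𝓝 0) := by simpa using hδ.const_mul ((m:ℝ)+1)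
    exact this.eventually_lt_const (by positivity)
  have hδ2 : ∀ᶠ j in atTop, (hh j)^2 < θ/2 := by
    have : Tendsto (fun j => (hh j)^2) atTop (𝓝 0) := by simpa using hδ.pow 2
    exact this.eventually_lt_const (by positivity)
  obtain ⟨j, hj, hj1, hj2⟩ := ((hbad ⌈D⌉₊ p (⌈|s|⌉₊ + 2)).and (hδ1.and hδ2)).exists
  apply hj
  have h0 := hh_pos j
  set δ := hh j with hδd
  have hδle : δ ≤ 1 := by rw [hδd, hh]; exact pow_le_one₀ (by norm_num) (by norm_num)
  have e2 : (2:ℝ)^j * δ = 1 := by rw [hδd, hh, ← mul_pow]; norm_num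
  have e4 : (4:ℝ)^j * δ^2 = 1 := by
    rw [hδd, hh, ← pow_mul, mul_comm j 2, pow_mul, ← mul_pow]; norm_num
  have p2 : (0:ℝ) < 2^j := by positivity
  have p21 : (1:ℝ) ≤ 2^j := one_le_pow₀ (by norm_num)
  have p4 : (0:ℝ) < 4^j := by positivity
  have i2 : ((2:ℝ)^j)⁻¹ = δ := by field_simp; linarith
  have i4 : ((4:ℝ)^j)⁻¹ = δ^2 := by field_simp; linarith
  set k : ℤ := ⌊(2:ℝ)^j * s⌋ + 1 with hk
  have k1 : (k:ℝ) ≤ 2^j * s + 1 := by rw [hk]; push_cast; linarith [Int.floor_le ((2:ℝ)^j * s)]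
  have k2 : (2:ℝ)^j * s < k := by rw [hk]; push_cast; linarith [Int.lt_floor_add_one ((2:ℝ)^j * s)]
  have hs1 := Nat.le_ceil |s|
  have hs2 := abs_le.1 (le_refl |s|)
  refine ⟨k, ?_, ?_, ⌊(4:ℝ)^j * θ⌋₊, ?_⟩
  · have : -(((⌈|s|⌉₊ + 2 : ℕ) : ℝ) * 2^j) ≤ (k:ℝ) := by push_cast; nlinarith [hs2.1]
    exact_mod_cast this
  · have : (k:ℝ) ≤ ((⌈|s|⌉₊ + 2 : ℕ) : ℝ) * 2^j := by push_cast; nlinarith [hs2.2]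
    exact_mod_cast this
  set q := ⌊(4:ℝ)^j * θ⌋₊ with hq
  have q1 : (q:ℝ) ≤ 4^j * θ := Nat.floor_le (by positivity)
  have q2 : (4:ℝ)^j * θ < q + 1 := Nat.lt_floor_add_one _
  set τ := (q:ℝ)/4^j with hτ
  have t1 : τ ≤ θ := by rw [hτ, div_le_iff₀ p4]; linarith
  have t2 : θ - δ^2 ≤ τ := by
    rw [hτ, le_div_iff₀ p4, sub_mul, mul_comm _ ((4:ℝ)^j), mul_comm _ ((4:ℝ)^j), e4]; linarith
  have hτI : τ ∈ Ioo (0:ℝ) 1 := ⟨by linarith, by linarith⟩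
  refine ⟨?_, ?_, ?_⟩
  · by_contra hc
    have : q = 0 := by omega
    rw [hτ, this] at t2
    simp at t2; linarith
  · have : (q:ℝ) < 4^j := by nlinarith
    exact_mod_cast this
  intro i hi
  have pt : ∀ l : ℕ, l ≤ m → |(FF W (((k + l : ℤ):ℝ)/2^j) τ).re - (FF W s θ).re| ≤
      (|C| * ((m:ℝ)+1)^2 + C1) * δ^(τ+ε') := by
    intro l hl
    set u := (((k + l : ℤ):ℝ)/2^j) with hu
    have hl' : (l:ℝ) ≤ m := by exact_mod_cast hl
    have hl0 : (0:ℝ) ≤ l := Nat.cast_nonneg l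
    have hus : u = (k + l) * δ := by rw [hu, div_eq_mul_inv, i2]; push_cast; ring
    have u1 : 0 ≤ u - s := by
      rw [hus]
      have : s = 2^j * s * δ := by linear_combination (-s) * e2
      nlinarith
    have u2 : u - s ≤ (m+1) * δ := by
      rw [hus]
      have : s = 2^j * s * δ := by linear_combination (-s) * e2
      nlinarith
    have u3 : u - s < 1 := by linarith [hj1.trans_le (min_le_right _ _)]
    have u4 : u - s < ρ := by linarith [hj1.trans_le (min_le_left _ _)]
    have A := hF (u - s) (by rwa [abs_of_nonneg u1])
    rw [add_sub_cancel, abs_of_nonneg u1] at A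
    have uI : u ∈ Icc (-(|s|+2)) (|s|+2) := ⟨by linarith, by linarith⟩
    have Bd := hiv u τ u θ uI ⟨by linarith, by linarith⟩ uI ⟨by linarith, by linarith⟩
    rw [max_eq_right t1, sub_self, abs_zero, Real.zero_rpow (by linarith), zero_add, abs_of_nonpos (show τ - θ ≤ 0 by linarith)] at Bd
    have r1 : (u-s)^(θ+ε) ≤ ((m:ℝ)+1)^2 * δ^(τ+ε') := by
      calc (u-s)^(θ+ε) ≤ ((m+1) * δ)^(θ+ε) := Real.rpow_le_rpow u1 u2 (by linarith)
        _ ≤ ((m+1) * δ)^(θ+ε') := Real.rpow_le_rpow_of_exponent_ge (by positivity)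
            (by linarith [hj1.trans_le (min_le_right _ _)]) (by linarith)
        _ = ((m:ℝ)+1)^(θ+ε') * δ^(θ+ε') := Real.mul_rpow (by positivity) h0.le
        _ ≤ ((m:ℝ)+1)^(2:ℝ) * δ^(τ+ε') := by
            apply mul_le_mul _ _ (by positivity) (by positivity)
            · exact Real.rpow_le_rpow_of_exponent_le (by linarith [(Nat.cast_nonneg m : (0:ℝ) ≤ m)]) (by linarith)
            · exact Real.rpow_le_rpow_of_exponent_ge h0 hδle (by linarith)
        _ = _ := by rw [Real.rpow_two]
    have r2 : δ^2 ≤ δ^(τ+ε') := by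
      rw [← Real.rpow_two]
      exact Real.rpow_le_rpow_of_exponent_ge h0 hδle (by linarith)
    have s1 : |C| * (u-s)^(θ+ε) ≤ |C| * (((m:ℝ)+1)^2 * δ^(τ+ε')) := by gcongr
    have s2 : C1 * -(τ - θ) ≤ C1 * δ^(τ+ε') := by
      apply mul_le_mul_of_nonneg_left _ hC1.le
      linarith
    have := abs_sub_le (FF W u τ).re (FF W u θ).re (FF W s θ).re
    linarith
  have a1 := pt i (by omega)
  have a2 := pt (i+1) (by omega)
  have hz : ((τ:ℝ):ℂ) ∈ UB := real_mem_UB hτI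
  rw [hW.FF_dyadic j _ hz] at a1 a2
  have ee : (k + ((i+1:ℕ):ℤ)) = (k + (i:ℤ)) + 1 := by push_cast; ring
  rw [ee, SS_succ, Complex.add_re] at a2
  have hpos : 0 < δ^(τ+ε') := by positivity
  have hc : D * δ^(τ+ε') ≤ (⌈D⌉₊:ℝ) * δ^(τ+ε') := by gcongr; exact Nat.le_ceil D
  refine le_trans ?_ hc
  rw [hD]
  rw [abs_le] at a1 a2 ⊢
  constructor <;> nlinarith [a1.1, a1.2, a2.1, a2.2]

/-- There exist a probability space and a random field `B̃` on `ℝ × (0,1)` which is a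
centered Gaussian field with the multifractional covariance, possessing a full event
`Ω*` on which: (i) `B̃(·,·,ω)` is continuous; (ii) at every `(s,θ)`, for every `ε > 0`
the increments are `o(|h|^{θ−ε})` and not `O(|h|^{θ+ε})`; (iii) `θ ↦ B̃(t,θ,ω)` is
`C^∞` on `(0,1)`; (iv) uniform Hölder-type estimates for all `θ`-derivatives. -/
theorem exists_modification_of_multifractional_field :
    ∃ (Ω : Type) (mΩ : MeasurableSpace Ω) (P : @MeasureTheory.Measure Ω mΩ),
      @IsProbabilityMeasure Ω mΩ P ∧
      ∃ B : ℝ → ℝ → Ω → ℝ,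
        -- (a) centered Gaussian field with the prescribed covariance
        (∀ (n : ℕ) (t θ : Fin n → ℝ), (∀ i, θ i ∈ Set.Ioo (0:ℝ) 1) →
          ∀ c : Fin n → ℝ, ∃ v : NNReal,
            @Measure.map Ω ℝ mΩ _ (fun ω => ∑ i, c i * B (t i) (θ i) ω) P
              = gaussianReal 0 v) ∧
        (∀ (t θ t' θ' : ℝ), θ ∈ Set.Ioo (0:ℝ) 1 → θ' ∈ Set.Ioo (0:ℝ) 1 →
          (∫ ω, B t θ ω * B t' θ' ω ∂P)
            = ∫ x : ℝ, fbmKernel θ t x * fbmKernel θ' t' x) ∧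
        -- (b) the full event Ω*
        ∃ Ωstar : Set Ω, MeasurableSet Ωstar ∧ P Ωstar = 1 ∧
          ∀ ω ∈ Ωstar,
            -- (i) joint continuity
            (ContinuousOn (fun p : ℝ × ℝ => B p.1 p.2 ω)
              (Set.univ ×ˢ Set.Ioo (0:ℝ) 1)) ∧
            -- (ii) pointwise Hölder behaviour in t
            (∀ ε : ℝ, 0 < ε → ∀ s : ℝ, ∀ θ ∈ Set.Ioo (0:ℝ) 1,
              Filter.Tendsto (fun h : ℝ =>
                  |B (s + h) θ ω - B s θ ω| / |h| ^ (θ - ε)) (𝓝[≠] 0) (𝓝 0) ∧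
              ∀ C : ℝ, ∃ᶠ h : ℝ in 𝓝[≠] 0,
                C < |B (s + h) θ ω - B s θ ω| / |h| ^ (θ + ε)) ∧
            -- (iii) smoothness in θ
            (∀ t : ℝ, ContDiffOn ℝ (⊤ : ℕ∞) (fun θ => B t θ ω) (Set.Ioo (0:ℝ) 1)) ∧
            -- (iv) increment estimate for all θ-derivatives
            (∀ (n : ℕ) (ε M a b : ℝ), 0 < ε → 0 < M → 0 < a → a < b → b < 1 →
              ∃ C : ℝ, 0 < C ∧
                ∀ t₁ θ₁ t₂ θ₂ : ℝ, t₁ ∈ Set.Icc (-M) M → θ₁ ∈ Set.Icc a b →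
                  t₂ ∈ Set.Icc (-M) M → θ₂ ∈ Set.Icc a b →
                  |iteratedDerivWithin n (fun θ => B t₁ θ ω) (Set.Ioo (0:ℝ) 1) θ₁
                    - iteratedDerivWithin n (fun θ => B t₂ θ ω) (Set.Ioo (0:ℝ) 1) θ₂|
                    ≤ C * (|t₁ - t₂| ^ (max θ₁ θ₂ - ε) + |θ₁ - θ₂|)) := by
  obtain ⟨Ω, mΩ, P, hP, X, h⟩ := exists_isoProc
  refine ⟨Ω, mΩ, P, hP, fun t θ ω => (FF (Wx (xc X ω)) t θ).re, ?_, ?_, ?_⟩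
  · intro n t θ hθ c
    have e1 : (fun ω => ∑ i, c i * (FF (Wx (xc X ω)) (t i) (θ i)).re) =ᵐ[P]
        X (fun x => ∑ i, c i * fbmKernel (θ i) (t i) x) := by
      have hall : ∀ᵐ ω ∂P, ∀ i, (FF (Wx (xc X ω)) (t i) (θ i)).re = X (fbmKernel (θ i) (t i)) ω :=
        ae_all_iff.2 fun i => h.FF_eq (hθ i) (t i)
      filter_upwards [hall, h.sum Finset.univ c (fun i => fbmKernel (θ i) (t i)) fun i _ => memLp_fbm (hθ i) (t i)]
        with ω h1 h2
      rw [h2]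
      exact Finset.sum_congr rfl fun i _ => by rw [h1 i]
    refine ⟨_, (Measure.map_congr e1).trans (h.law _ ?_)⟩
    exact memLp_finsetSum _ fun i _ => (memLp_fbm (hθ i) (t i)).const_mul (c i)
  · intro t θ t' θ' hθ hθ'
    rw [← h.inner _ _ (memLp_fbm hθ t) (memLp_fbm hθ' t')]
    apply integral_congr_ae
    filter_upwards [h.FF_eq hθ t, h.FF_eq hθ' t'] with ω h1 h2
    rw [h1, h2]
  · have hE : ∀ᵐ ω ∂P, ∀ (j : ℕ) (k : ℤ) (q : ℕ), ((q:ℝ)/4^j) ∈ Ioo (0:ℝ) 1 →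
        Wx (xc X ω) j k (((q:ℝ)/4^j : ℝ) : ℂ) = (X (incf ((q:ℝ)/4^j) j k) ω : ℂ) := by
      rw [ae_all_iff]; intro j
      rw [ae_all_iff]; intro k
      rw [ae_all_iff]; intro q
      by_cases hq : ((q:ℝ)/4^j) ∈ Ioo (0:ℝ) 1
      · filter_upwards [h.W_eq hq j k] with ω hω _
        exact hω
      · exact ae_of_all _ fun ω h' => absurd h' hq
    obtain ⟨S, hS, hSm, hSP⟩ := (h.ae_good.and (hE.and h.ae_not_bad)).exists_measurable_mem
    refine ⟨S, hSm, by rw [← mem_ae_iff_prob_eq_one hSm]; exact hS, ?_⟩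
    intro ω hω
    obtain ⟨hG, hW, hB⟩ := hSP ω hω
    have hg := hG.goodW
    refine ⟨hg.cont, ?_, fun t => contDiffOn_re (hg.FF_diff t), ?_⟩
    · intro ε hε s θ hθ
      refine ⟨hg.holder_ptwise hε s hθ, fun C => hg.lower ?_ hε s hθ C⟩
      intro C p M
      filter_upwards [hB C p M] with j hj hex
      apply hj
      obtain ⟨k, hk1, hk2, q, hq1, hq2, hi⟩ := hex
      have hθq : (q:ℝ)/4^j ∈ Ioo (0:ℝ) 1 := by
        have : 0 < (q:ℝ) := Nat.cast_pos.2 (by omega)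
        refine ⟨by positivity, ?_⟩
        rw [div_lt_one (by positivity)]; exact_mod_cast hq2
      simp only [IsoProc.badE, Set.mem_iUnion]
      refine ⟨k, Finset.mem_Icc.2 ⟨hk1, hk2⟩, q, Finset.mem_Ico.2 ⟨hq1, hq2⟩, fun i him => ?_⟩
      have := hi i him
      rwa [hW j _ q hθq, Complex.ofReal_re] at this
    · intro n ε M a b hε hM ha hab hb
      obtain ⟨C, hC, hb'⟩ := hg.iv_aux n hε hM ha hab hb
      refine ⟨C, hC, fun t₁ θ₁ t₂ θ₂ h1 h2 h3 h4 => ?_⟩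
      rw [iteratedDerivWithin_re (hg.FF_diff t₁) n θ₁ ⟨by linarith [h2.1], by linarith [h2.2]⟩,
        iteratedDerivWithin_re (hg.FF_diff t₂) n θ₂ ⟨by linarith [h4.1], by linarith [h4.2]⟩]
      exact hb' t₁ θ₁ t₂ θ₂ h1 h2 h3 h4

end
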